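/- arXiv:1606.04294 — 2 statements merged into one kernel-verified Lean document; each statement's English description precedes it below -/
import Mathlib

section
/- Let 0 < α < n and let I_α be the Riesz potential I_α f(x) = ∫_{ℝⁿ} |x−y|^{α−n} f(y) dy. Let p : ℝⁿ → (0,∞) satisfy the local log-Hölder condition and the log-Hölder condition at infinity with 0 < p₋ ≤ p₊ < n/α, define q by 1/q(x) = 1/p(x) − α/n, let max(1,p₊) < p₀ < n/α, and let d ≥ d_{p(·)} be an integer with n − α + d + 1 ≥ 2n + 2d_{q(·)} + 3. Then there is a constant C, independent of the atom, such that for every (p(·),p₀,d)-atom a supported in a cube Q = Q(z,r) and every x ∉ 2√n Q, |I_α a(x)| ≤ C ‖χ_Q‖_{q(·)}^{−1} (1 + |x−z|/r)^{−(2n + 2d_{q(·)} + 3)}. -/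
open MeasureTheory ENNReal

noncomputable section

abbrev Rn (n : ℕ) := EuclideanSpace ℝ (Fin n)

/-- The variable exponent Lebesgue quasinorm of an `ℝ≥0∞`-valued function. -/
def varLpNormE {n : ℕ} (p : Rn n → ℝ) (g : Rn n → ℝ≥0∞) : ℝ≥0∞ :=
  sInf {l : ℝ≥0∞ | ∃ lam : ℝ, 0 < lam ∧ l = ENNReal.ofReal lam ∧
    (∫⁻ x, (g x / ENNReal.ofReal lam) ^ (p x)) ≤ 1}

/-- The variable exponent Lebesgue quasinorm `‖f‖_{p(·)}`. -/
def varLpNorm {n : ℕ} (p : Rn n → ℝ) (f : Rn n → ℝ) : ℝ≥0∞ :=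
  varLpNormE p (fun x => ENNReal.ofReal |f x|)

/-- The local log-Hölder continuity condition. -/
def LogHolderLocal {n : ℕ} (p : Rn n → ℝ) : Prop :=
  ∃ c > 0, ∀ x y : Rn n, ‖x - y‖ < 1/2 → |p x - p y| ≤ c / (-Real.log ‖x - y‖)

/-- The log-Hölder condition at infinity. -/
def LogHolderInfty {n : ℕ} (p : Rn n → ℝ) : Prop :=
  ∃ C > 0, ∃ pinf : ℝ, ∀ x : Rn n, |p x - pinf| ≤ C / Real.log (Real.exp 1 + ‖x‖)

/-- The (closed) cube centered at `z` with side length `r`. -/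
def cube {n : ℕ} (z : Rn n) (r : ℝ) : Set (Rn n) := {x | ∀ i, |x i - z i| ≤ r / 2}

/-- The characteristic function of the cube `Q(z,r)`. -/
def cubeInd {n : ℕ} (z : Rn n) (r : ℝ) : Rn n → ℝ := Set.indicator (cube z r) 1

/-- The fractional maximal operator `M_β`. -/
def fracMax {n : ℕ} (β : ℝ) (f : Rn n → ℝ) (x : Rn n) : ℝ :=
  ⨆ (z : Rn n) (r : ℝ) (_ : 0 < r) (_ : x ∈ cube z r),
    (volume (cube z r)).toReal ^ (β / (n : ℝ) - 1) * ∫ y in cube z r, |f y|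

/-- `p̲ = min (p₋, 1)`. -/
def pUnder {n : ℕ} (p : Rn n → ℝ) : ℝ := min (⨅ x, p x) 1

/-- The quantity `𝒜({λ_j},{Q_j},p(·))`. -/
def AFun {n : ℕ} (p : Rn n → ℝ) (lam : ℕ → ℝ) (z : ℕ → Rn n) (r : ℕ → ℝ) : ℝ≥0∞ :=
  varLpNorm p (fun x =>
    (∑' j, (lam j * cubeInd (z j) (r j) x /
        (varLpNorm p (cubeInd (z j) (r j))).toReal) ^ pUnder p) ^ (1 / pUnder p))

/-- `d_{p(·)} = min {ℓ ∈ ℕ : p₋ (n + ℓ + 1) > n}` where `t` plays the role of `p₋`. -/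
def dIndex (n : ℕ) (t : ℝ) : ℕ := sInf {l : ℕ | t * (n + l + 1) > n}

/-- `p₋`, the essential lower bound of the exponent. -/
def pLow {n : ℕ} (p : Rn n → ℝ) : ℝ := ⨅ x, p x

/-- A `(p(·), p₀, d)`-atom supported in the cube `Q(z,r)`. -/
structure IsPAtom {n : ℕ} (p : Rn n → ℝ) (p₀ : ℝ) (d : ℕ) (a : Rn n → ℝ)
    (z : Rn n) (r : ℝ) : Prop where
  measurable : Measurable a
  support : ∀ x, x ∉ cube z r → a x = 0
  size : eLpNorm a (ENNReal.ofReal p₀) volume ≤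
    ENNReal.ofReal ((volume (cube z r)).toReal ^ (1 / p₀)) / varLpNorm p (cubeInd z r)
  moments : ∀ γ : Fin n → ℕ, (∑ i, γ i) ≤ d → ∫ x, a x * ∏ i, x i ^ γ i = 0

/-- Action of an `n × n` matrix on `ℝⁿ`. -/
def mApp {n : ℕ} (A : Matrix (Fin n) (Fin n) ℝ) (x : Rn n) : Rn n :=
  Matrix.toEuclideanLin A x

/-- The operator norm of a matrix acting on Euclidean space. -/
def opNorm {n : ℕ} (A : Matrix (Fin n) (Fin n) ℝ) : ℝ :=
  ‖Matrix.toEuclideanCLM (𝕜 := ℝ) A‖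

/-- The kernel `k(x,y) = |x - A₁ y|^{-α₁} ⋯ |x - A_m y|^{-α_m}`. -/
def kern {n m : ℕ} (A : Fin m → Matrix (Fin n) (Fin n) ℝ) (αe : Fin m → ℝ)
    (x y : Rn n) : ℝ :=
  ∏ i, ‖x - mApp (A i) y‖ ^ (-(αe i))

/-- The fractional type integral operator `T_α`. -/
def Tα {n m : ℕ} (A : Fin m → Matrix (Fin n) (Fin n) ℝ) (αe : Fin m → ℝ)
    (f : Rn n → ℝ) (x : Rn n) : ℝ :=
  ∫ y, kern A αe x y * f y

/-- The Riesz potential `I_α`. -/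
def riesz {n : ℕ} (α : ℝ) (f : Rn n → ℝ) (x : Rn n) : ℝ :=
  ∫ y, ‖x - y‖ ^ (α - (n : ℝ)) * f y

/-- Partial derivative in the `i`-th coordinate direction. -/
def pderiv1 {n : ℕ} (i : Fin n) (g : Rn n → ℝ) : Rn n → ℝ :=
  fun x => fderiv ℝ g x (EuclideanSpace.single i 1)

/-- The multiindex partial derivative `∂^γ`. -/
def mderiv {n : ℕ} (γ : Fin n → ℕ) (g : Rn n → ℝ) : Rn n → ℝ :=
  (List.finRange n).foldr (fun i h => (pderiv1 i)^[γ i] h) g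

/-- The finite set of multiindices `γ` with `|γ| ≤ N`. -/
def multiIndices (n N : ℕ) : Finset (Fin n → ℕ) :=
  (Fintype.piFinset fun _ => Finset.range (N+1)).filter (fun γ => (∑ i, γ i) ≤ N)

/-- The family `F_N` of normalized Schwartz test functions. -/
def FN (n N : ℕ) : Set (SchwartzMap (Rn n) ℝ) :=
  {φ | (∑ γ ∈ multiIndices n N, ⨆ x : Rn n, (1 + ‖x‖) ^ N * |mderiv γ (⇑φ) x|) ≤ 1}

/-- The grand maximal function `𝓜 f`. -/
def grandMax (n N : ℕ) (f : Rn n → ℝ) (x : Rn n) : ℝ≥0∞ :=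
  ⨆ (t : ℝ) (_ : 0 < t) (φ : FN n N),
    ENNReal.ofReal |∫ y, t ^ (-(n : ℝ)) * (φ : SchwartzMap (Rn n) ℝ) (t⁻¹ • (x - y)) * f y|

/-- The variable Hardy space quasinorm `‖f‖_{H^{p(·)}}` (with parameter `N`). -/
def hardyNorm {n : ℕ} (p : Rn n → ℝ) (N : ℕ) (f : Rn n → ℝ) : ℝ≥0∞ :=
  varLpNormE p (grandMax n N f)

/-- `γ! = γ₁! ⋯ γ_n!`. -/
def mfact {n : ℕ} (γ : Fin n → ℕ) : ℕ := ∏ i, (γ i).factorial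

/-- The degree-`d` Taylor polynomial of `g` at `z`, evaluated at `y`. -/
def taylorPoly {n : ℕ} (d : ℕ) (g : Rn n → ℝ) (z y : Rn n) : ℝ :=
  ∑ γ ∈ multiIndices n d, (mderiv γ g z / (mfact γ : ℝ)) * ∏ i, (y i - z i) ^ γ i

end

theorem taylor_kernel (n : ℕ) (s : ℝ) (d : ℕ) :
    ∃ C > 0, ∀ u w : Rn n, ‖u‖ = 1 → ‖w‖ ≤ 1/2 →
      |‖u - w‖ ^ s - ∑ k ∈ Finset.range (d + 1), ((k.factorial : ℝ))⁻¹ *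
        (iteratedFDeriv ℝ k (fun v : Rn n => ‖v‖ ^ s) u (fun _ => -w))| ≤ C * ‖w‖ ^ (d + 1) := by
  set F : Rn n → ℝ := fun v => ‖v‖ ^ s with hF
  have hsm : ∀ v : Rn n, v ≠ 0 → ContDiffAt ℝ (d + 1 : ℕ) F v := by
    intro v hv
    exact (contDiffAt_norm ℝ hv).rpow_const_of_ne (norm_ne_zero_iff.mpr hv)
  set A : Set (Rn n) := Metric.closedBall 0 (3/2) \ Metric.ball 0 (1/2) with hA
  have hAc : IsCompact A := (isCompact_closedBall _ _).diff Metric.isOpen_ball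
  have hcont : ContinuousOn (fun v => iteratedFDeriv ℝ (d + 1) F v) A := by
    intro v hv
    have hv0 : v ≠ 0 := by
      rintro rfl
      simp [hA] at hv
    exact ((hsm v hv0).iteratedFDeriv_right (m := 0) (i := d + 1) (by simp)).continuousAt.continuousWithinAt
  obtain ⟨C, hC⟩ := hAc.exists_bound_of_continuousOn hcont
  refine ⟨|C| + 1, by positivity, ?_⟩
  intro u w hu hw
  have hmem : ∀ t ∈ Set.Icc (0:ℝ) 1, u + t • (-w) ∈ A := by
    intro t ht
    have h1 : ‖t • (-w)‖ ≤ 1/2 := by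
      rw [norm_smul, norm_neg, Real.norm_of_nonneg ht.1]
      nlinarith [ht.1, ht.2, norm_nonneg w]
    simp only [hA, Set.mem_sdiff, Metric.mem_closedBall, dist_zero_right, Metric.mem_ball, not_lt]
    constructor
    · linarith [norm_add_le u (t • (-w))]
    · have := norm_sub_norm_le u (-(t • (-w)))
      rw [sub_neg_eq_add, norm_neg] at this
      linarith
  have hne : ∀ t ∈ Set.Icc (0:ℝ) 1, u + t • (-w) ≠ 0 := by
    intro t ht h0
    have := hmem t ht
    rw [h0] at this
    simp [hA] at this
  have key := map_add_eq_sum_add_integral_iteratedFDeriv (n := d) (f := F) (x := u) (y := -w)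
    (fun t ht => by exact_mod_cast hsm _ (hne t ht))
  have hFe : F (u + -w) = ‖u - w‖ ^ s := by simp [hF, sub_eq_add_neg]
  rw [← hFe, key]
  simp only [smul_eq_mul, add_sub_cancel_left]
  have hint : ‖∫ t in (0:ℝ)..1, (1 - t) ^ d * (iteratedFDeriv ℝ (d + 1) F (u + t • (-w)) fun _ => -w)‖
      ≤ ((|C| + 1) * ‖w‖ ^ (d + 1)) * |1 - 0| := by
    apply intervalIntegral.norm_integral_le_of_norm_le_const
    intro t ht
    rw [Set.uIoc_of_le zero_le_one] at ht
    have ht' : t ∈ Set.Icc (0:ℝ) 1 := ⟨ht.1.le, ht.2⟩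
    rw [norm_mul]
    have h1 : ‖(1 - t) ^ d‖ ≤ 1 := by
      rw [norm_pow]
      apply pow_le_one₀ (norm_nonneg _)
      rw [Real.norm_eq_abs, abs_le]; constructor <;> linarith [ht.1, ht.2]
    have h2 := (iteratedFDeriv ℝ (d + 1) F (u + t • (-w))).le_opNorm (fun _ => -w)
    simp only [norm_neg, Finset.prod_const, Finset.card_univ, Fintype.card_fin] at h2
    have h3 := hC _ (hmem t ht')
    calc _ ≤ 1 * (‖iteratedFDeriv ℝ (d + 1) F (u + t • (-w))‖ * ‖w‖ ^ (d + 1)) := by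
          gcongr
      _ ≤ _ := by
          rw [one_mul]
          gcongr
          linarith [le_abs_self C]
  rw [abs_mul, abs_of_nonneg (by positivity)]
  rw [Real.norm_eq_abs] at hint
  simp only [sub_zero, abs_one, mul_one] at hint
  have hfac : ((d.factorial : ℝ))⁻¹ ≤ 1 := inv_le_one_of_one_le₀ (by exact_mod_cast Nat.succ_le_of_lt d.factorial_pos)
  calc _ ≤ 1 * |∫ t in (0:ℝ)..1, (1 - t) ^ d * (iteratedFDeriv ℝ (d + 1) F (u + t • (-w)) fun _ => -w)| := by
        gcongr
    _ ≤ _ := by rw [one_mul]; exact hint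

theorem multilin_poly {n k : ℕ} (M : ContinuousMultilinearMap ℝ (fun _ : Fin k => Rn n) ℝ)
    (z : Rn n) (c : ℝ) :
    ∃ P : MvPolynomial (Fin n) ℝ, P.totalDegree ≤ k ∧
      ∀ y : Rn n, M (fun _ => c • (y - z)) = MvPolynomial.eval (fun i => y i) P := by
  classical
  refine ⟨∑ r : Fin k → Fin n, MvPolynomial.C (M fun i => EuclideanSpace.single (r i) (1:ℝ)) *
    ∏ i, (MvPolynomial.C c * (MvPolynomial.X (r i) - MvPolynomial.C (z (r i)))), ?_, ?_⟩
  · apply MvPolynomial.totalDegree_finsetSum_le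
    intro r _
    refine (MvPolynomial.totalDegree_mul _ _).trans ?_
    rw [MvPolynomial.totalDegree_C, zero_add]
    refine (MvPolynomial.totalDegree_finsetProd _ _).trans ?_
    calc _ ≤ ∑ i : Fin k, 1 := by
          apply Finset.sum_le_sum
          intro i _
          refine (MvPolynomial.totalDegree_mul _ _).trans ?_
          rw [MvPolynomial.totalDegree_C, zero_add]
          refine (MvPolynomial.totalDegree_sub _ _).trans ?_
          simp [MvPolynomial.totalDegree_X]
      _ = k := by simp
  · intro y
    have hy : c • (y - z) = ∑ j : Fin n, (c * (y j - z j)) • EuclideanSpace.single j (1:ℝ) := by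
      ext i
      simp [Finset.sum_apply, Pi.single_apply]
    rw [hy]
    rw [M.map_sum (fun _ j => (c * (y j - z j)) • EuclideanSpace.single j (1:ℝ))]
    rw [map_sum]
    refine Finset.sum_congr rfl fun r _ => ?_
    rw [M.map_smul_univ]
    simp [mul_comm]

theorem cube_eq_preimage {n : ℕ} (z : Rn n) (r : ℝ) :
    cube z r = (WithLp.ofLp) ⁻¹' (Set.Icc (fun i => z i - r/2) (fun i => z i + r/2)) := by
  ext x
  simp only [cube, Set.mem_ofPred_eq, Set.mem_preimage, Set.mem_Icc, Pi.le_def, abs_le]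
  constructor
  · intro h
    exact ⟨fun i => by linarith [(h i).1], fun i => by linarith [(h i).2]⟩
  · rintro ⟨h1, h2⟩ i
    exact ⟨by linarith [h1 i], by linarith [h2 i]⟩

theorem cube_measurable {n : ℕ} (z : Rn n) (r : ℝ) : MeasurableSet (cube z r) := by
  rw [cube_eq_preimage]
  exact (PiLp.volume_preserving_ofLp (Fin n)).measurable measurableSet_Icc

theorem cube_volume {n : ℕ} (z : Rn n) (r : ℝ) (hr : 0 ≤ r) :
    volume (cube z r) = ENNReal.ofReal (r ^ n) := by
  rw [cube_eq_preimage, (PiLp.volume_preserving_ofLp (Fin n)).measure_preimage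
    measurableSet_Icc.nullMeasurableSet, Real.volume_Icc_pi]
  simp only [add_sub_sub_cancel, add_halves, Finset.prod_const, Finset.card_univ, Fintype.card_fin]
  rw [ENNReal.ofReal_pow hr]

theorem cube_norm_le {n : ℕ} {z y : Rn n} {r : ℝ} (hr : 0 ≤ r) (hy : y ∈ cube z r) :
    ‖y - z‖ ≤ Real.sqrt n * r / 2 := by
  rw [EuclideanSpace.norm_eq]
  have : ∑ i, ‖(y - z) i‖ ^ 2 ≤ n * (r/2)^2 := by
    calc _ ≤ ∑ i : Fin n, (r/2)^2 := by
          apply Finset.sum_le_sum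
          intro i _
          have := hy i
          simp only [PiLp.sub_apply, Real.norm_eq_abs]
          gcongr
      _ = _ := by simp
  calc _ ≤ Real.sqrt (n * (r/2)^2) := Real.sqrt_le_sqrt this
    _ = _ := by
      rw [Real.sqrt_mul (by positivity), Real.sqrt_sq (by positivity)]; ring

theorem not_mem_cube {n : ℕ} {z x : Rn n} {r : ℝ} (hx : x ∉ cube z (2 * Real.sqrt n * r)) :
    Real.sqrt n * r ≤ ‖x - z‖ := by
  simp only [cube, Set.mem_ofPred_eq, not_forall, not_le] at hx
  obtain ⟨i, hi⟩ := hx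
  have := PiLp.norm_apply_le (x - z) i
  simp only [PiLp.sub_apply, Real.norm_eq_abs] at this
  linarith


theorem atom_l1 {n : ℕ} {p : Rn n → ℝ} {p₀ : ℝ} (hp₀ : 1 < p₀) {d : ℕ} {a : Rn n → ℝ}
    {z : Rn n} {r : ℝ} (hr : 0 < r) (h : IsPAtom p p₀ d a z r) :
    eLpNorm a 1 volume ≤ ENNReal.ofReal (r ^ n) / varLpNorm p (cubeInd z r) := by
  have hind : (cube z r).indicator a = a := by
    apply Set.indicator_eq_self.mpr
    intro y hy
    by_contra hc
    exact hy (h.support y hc)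
  have h1 : eLpNorm a 1 volume = eLpNorm a 1 (volume.restrict (cube z r)) := by
    conv_lhs => rw [← hind]
    rw [eLpNorm_indicator_eq_eLpNorm_restrict (cube_measurable z r)]
  have h2 : eLpNorm a (ENNReal.ofReal p₀) volume =
      eLpNorm a (ENNReal.ofReal p₀) (volume.restrict (cube z r)) := by
    conv_lhs => rw [← hind]
    rw [eLpNorm_indicator_eq_eLpNorm_restrict (cube_measurable z r)]
  have h3 := eLpNorm_le_eLpNorm_mul_rpow_measure_univ (μ := volume.restrict (cube z r)) (f := a)
    (p := 1) (q := ENNReal.ofReal p₀) (by rw [ENNReal.one_le_ofReal]; exact hp₀.le)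
    h.measurable.aestronglyMeasurable
  rw [← h1, ← h2, Measure.restrict_apply_univ] at h3
  have hs := h.size
  rw [cube_volume z r hr.le] at h3 hs
  have hrn : (0:ℝ) < r ^ n := by positivity
  rw [ENNReal.toReal_ofReal hrn.le] at hs
  rw [ENNReal.toReal_one, ENNReal.toReal_ofReal (by linarith), ENNReal.ofReal_rpow_of_pos hrn] at h3
  calc _ ≤ _ := h3
    _ ≤ (ENNReal.ofReal ((r ^ n) ^ (1 / p₀)) / varLpNorm p (cubeInd z r)) *
        ENNReal.ofReal ((r ^ n) ^ ((1:ℝ) / 1 - 1 / p₀)) := by gcongr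
    _ = _ := by
      have e : 1 / p₀ + ((1:ℝ) / 1 - 1 / p₀) = 1 := by ring
      rw [div_eq_mul_inv, mul_right_comm, ← ENNReal.ofReal_mul (by positivity),
        ← Real.rpow_add hrn, e, Real.rpow_one, div_eq_mul_inv]

theorem atom_mul_integrable {n : ℕ} {a : Rn n → ℝ} {z : Rn n} {r : ℝ} (hr : 0 < r)
    (hsup : ∀ x, x ∉ cube z r → a x = 0) (ha : Integrable a) {g : Rn n → ℝ} (hg : Continuous g) :
    Integrable (fun y => a y * g y) := by
  obtain ⟨B, hB⟩ := (isCompact_closedBall z (Real.sqrt n * r / 2)).exists_bound_of_continuousOn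
    hg.continuousOn
  refine (ha.norm.mul_const B).mono' (ha.1.mul hg.aestronglyMeasurable) ?_
  refine Filter.Eventually.of_forall fun y => ?_
  by_cases hy : y ∈ cube z r
  · rw [norm_mul]
    gcongr
    apply hB
    rw [mem_closedBall_iff_norm]
    exact cube_norm_le hr.le hy
  · simp [hsup y hy]

theorem atom_poly {n : ℕ} {p : Rn n → ℝ} {p₀ : ℝ} {d : ℕ} {a : Rn n → ℝ}
    {z : Rn n} {r : ℝ} (hr : 0 < r) (h : IsPAtom p p₀ d a z r) (ha : Integrable a)
    (P : MvPolynomial (Fin n) ℝ) (hP : P.totalDegree ≤ d) :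
    ∫ y, a y * MvPolynomial.eval (fun i => y i) P = 0 := by
  simp_rw [MvPolynomial.eval_eq', Finset.mul_sum]
  rw [integral_finsetSum]
  · apply Finset.sum_eq_zero
    intro m hm
    have := h.moments (fun i => m i) (by
      refine le_trans ?_ hP
      have := MvPolynomial.le_totalDegree hm
      rwa [Finsupp.sum_fintype _ _ (by simp)] at this)
    calc _ = ∫ y, P.coeff m * (a y * ∏ i, y i ^ m i) := by
          congr 1; ext y; ring
      _ = 0 := by rw [integral_const_mul, this, mul_zero]
  · intro m hm
    apply atom_mul_integrable hr h.support ha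
    fun_prop

theorem riesz_bound {n : ℕ} (hn : 0 < n) (s : ℝ) (d : ℕ) :
    ∃ C > 0, ∀ (p : Rn n → ℝ) (p₀ : ℝ) (a : Rn n → ℝ) (z : Rn n) (r : ℝ), 0 < r →
      IsPAtom p p₀ d a z r → Integrable a → ∀ x ∉ cube z (2 * Real.sqrt n * r),
      |∫ y, ‖x - y‖ ^ s * a y| ≤ C * (‖x - z‖ ^ s * (r / ‖x - z‖) ^ (d + 1)) * ∫ y, ‖a y‖ := by
  obtain ⟨C, hC, hT⟩ := taylor_kernel n s d
  refine ⟨C * (Real.sqrt n / 2) ^ (d + 1), by positivity, ?_⟩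
  intro p p₀ a z r hr h ha x hx
  have hR := not_mem_cube hx
  have hsn : 0 < Real.sqrt n := Real.sqrt_pos.mpr (by exact_mod_cast hn)
  set R := ‖x - z‖ with hRdef
  have hR0 : 0 < R := lt_of_lt_of_le (by positivity) hR
  set u : Rn n := R⁻¹ • (x - z) with hu
  have hu1 : ‖u‖ = 1 := by
    rw [hu, norm_smul, norm_inv, Real.norm_of_nonneg hR0.le, ← hRdef]
    field_simp
  choose P hPd hPe using fun k : ℕ =>
    multilin_poly (iteratedFDeriv ℝ k (fun v : Rn n => ‖v‖ ^ s) u) z (-R⁻¹)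
  set G : Rn n → ℝ := fun y => R ^ s * ∑ k ∈ Finset.range (d + 1),
    ((k.factorial : ℝ))⁻¹ * MvPolynomial.eval (fun i => y i) (P k) with hG
  have hGc : Continuous G := by
    apply continuous_const.mul
    apply continuous_finsetSum
    intro k _
    apply continuous_const.mul
    simp_rw [MvPolynomial.eval_eq']
    fun_prop
  have hGint : ∫ y, a y * G y = 0 := by
    calc _ = ∫ y, ∑ k ∈ Finset.range (d + 1), (R ^ s * ((k.factorial : ℝ))⁻¹) *
          (a y * MvPolynomial.eval (fun i => y i) (P k)) := by
          congr 1; ext y; simp only [hG, Finset.mul_sum]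
          refine Finset.sum_congr rfl fun k _ => by ring
      _ = 0 := by
          rw [integral_finsetSum]
          · apply Finset.sum_eq_zero
            intro k hk
            rw [integral_const_mul, atom_poly hr h ha, mul_zero]
            exact (hPd k).trans (Nat.lt_succ_iff.mp (Finset.mem_range.mp hk))
          · intro k _
            apply Integrable.const_mul
            apply atom_mul_integrable hr h.support ha
            simp_rw [MvPolynomial.eval_eq']
            fun_prop
  have hbound : ∀ y, ‖(‖x - y‖ ^ s - G y) * a y‖ ≤
      (C * (Real.sqrt n / 2) ^ (d + 1)) * (R ^ s * (r / R) ^ (d + 1)) * ‖a y‖ := by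
    intro y
    by_cases hy : y ∈ cube z r
    · rw [norm_mul]
      gcongr
      have hyz := cube_norm_le hr.le hy
      set w : Rn n := R⁻¹ • (y - z) with hw
      have hwn : ‖w‖ = ‖y - z‖ / R := by
        rw [hw, norm_smul, norm_inv, Real.norm_of_nonneg hR0.le]; field_simp
      have hwl : ‖w‖ ≤ 1/2 := by
        rw [hwn, div_le_iff₀ hR0]; linarith
      have hT' := hT u w hu1 hwl
      have hxy : ‖x - y‖ = R * ‖u - w‖ := by
        have : u - w = R⁻¹ • (x - y) := by
          rw [hu, hw, ← smul_sub]; congr 1; abel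
        rw [this, norm_smul, norm_inv, Real.norm_of_nonneg hR0.le]; field_simp
      have hxs : ‖x - y‖ ^ s = R ^ s * ‖u - w‖ ^ s := by
        rw [hxy, Real.mul_rpow hR0.le (norm_nonneg _)]
      have hGy : G y = R ^ s * ∑ k ∈ Finset.range (d + 1), ((k.factorial : ℝ))⁻¹ *
        (iteratedFDeriv ℝ k (fun v : Rn n => ‖v‖ ^ s) u (fun _ => -w)) := by
        simp only [hG]
        congr 1
        refine Finset.sum_congr rfl fun k _ => ?_
        rw [← hPe k y, hw]
        simp only [neg_smul]
      rw [hxs, hGy, ← mul_sub, norm_mul, Real.norm_of_nonneg (by positivity : 0 ≤ R ^ s), Real.norm_eq_abs]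
      calc _ ≤ R ^ s * (C * ‖w‖ ^ (d + 1)) := by gcongr
        _ ≤ R ^ s * (C * (Real.sqrt n * r / 2 / R) ^ (d + 1)) := by
            rw [hwn]; gcongr
        _ = _ := by
            have : Real.sqrt n * r / 2 / R = (Real.sqrt n / 2) * (r / R) := by ring
            rw [this, mul_pow]; ring
    · simp [h.support y hy]
  have hDm : AEStronglyMeasurable (fun y => (‖x - y‖ ^ s - G y) * a y) volume := by
    apply Measurable.aestronglyMeasurable
    have := hGc.measurable
    have := h.measurable
    fun_prop
  have hDi : Integrable (fun y => (‖x - y‖ ^ s - G y) * a y) :=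
    (ha.norm.const_mul _).mono' hDm (Filter.Eventually.of_forall hbound)
  have heq : ∫ y, ‖x - y‖ ^ s * a y = ∫ y, (‖x - y‖ ^ s - G y) * a y := by
    have hGi := atom_mul_integrable hr h.support ha hGc
    calc _ = ∫ y, ((‖x - y‖ ^ s - G y) * a y + a y * G y) := by
          congr 1; ext y; ring
      _ = _ := by rw [integral_add hDi hGi, hGint, add_zero]
  rw [heq, ← Real.norm_eq_abs, ← integral_const_mul]
  exact norm_integral_le_of_norm_le (ha.norm.const_mul _) (Filter.Eventually.of_forall hbound)


theorem modular_eq {n : ℕ} (p : Rn n → ℝ) (hp : ∀ x, 0 < p x) (z : Rn n) (r l : ℝ) (hl : 0 < l) :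
    (∫⁻ x, (ENNReal.ofReal |cubeInd z r x| / ENNReal.ofReal l) ^ (p x)) =
      ∫⁻ x in cube z r, ENNReal.ofReal (l ^ (-(p x))) := by
  rw [← lintegral_indicator (cube_measurable z r)]
  congr 1
  ext x
  by_cases hx : x ∈ cube z r
  · simp only [cubeInd, Set.indicator_of_mem hx, Pi.one_apply, abs_one]
    rw [← ENNReal.ofReal_div_of_pos hl, ENNReal.ofReal_rpow_of_pos (by positivity), one_div,
      Real.inv_rpow hl.le, ← Real.rpow_neg hl.le]
  · simp only [cubeInd, Set.indicator_of_notMem hx, abs_zero, ENNReal.ofReal_zero, ENNReal.zero_div]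
    exact ENNReal.zero_rpow_of_pos (hp x)

theorem osc_small {n : ℕ} (hn : 0 < n) (p : Rn n → ℝ) (hploc : LogHolderLocal p)
    (pm pp : ℝ) (hpm : 0 < pm) (hpmle : ∀ x, pm ≤ p x) (hple : ∀ x, p x ≤ pp) :
    ∃ L > 0, ∀ (z : Rn n) (r : ℝ), 0 < r → r ≤ 1 → ∀ x ∈ cube z r, ∀ y ∈ cube z r,
      |p x - p y| * |Real.log r| ≤ L := by
  obtain ⟨c, hc, h⟩ := hploc
  have hn1 : (1:ℝ) ≤ n := by exact_mod_cast hn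
  have hpp : 0 < pp := lt_of_lt_of_le hpm ((hpmle 0).trans (hple 0))
  have hl4 : 0 < Real.log (4 * n) := Real.log_pos (by linarith)
  refine ⟨2 * c + pp * Real.log (4 * n), by positivity, ?_⟩
  intro z r hr hr1 x hx y hy
  have hlog : Real.log r ≤ 0 := Real.log_nonpos hr.le hr1
  rw [abs_of_nonpos hlog]
  have hsn : Real.sqrt n ≤ n := by
    rw [Real.sqrt_le_left (by linarith)]; nlinarith
  have hsn0 : 0 < Real.sqrt n := Real.sqrt_pos.mpr (by linarith)
  by_cases hrs : r ≤ 1 / (4 * n)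
  · have hd : ‖x - y‖ ≤ Real.sqrt n * r := by
      have h1 := cube_norm_le hr.le hx
      have h2 := cube_norm_le hr.le hy
      have h3 := norm_sub_le (x - z) (y - z)
      rw [sub_sub_sub_cancel_right] at h3
      linarith
    have hrn : n * r ≤ 1/4 := by
      rw [le_div_iff₀ (by positivity)] at hrs; linarith
    have hlt : ‖x - y‖ < 1/2 := by nlinarith
    rcases eq_or_ne x y with rfl | hne
    · simp; positivity
    have hpos : 0 < ‖x - y‖ := norm_pos_iff.mpr (sub_ne_zero.mpr hne)
    have hb := h x y hlt
    have hlr : Real.log (4 * n) ≤ -Real.log r := by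
      rw [← Real.log_inv]
      apply Real.log_le_log (by positivity)
      rw [le_inv_comm₀ (by positivity) hr, ← one_div]; exact hrs
    have h5 : Real.log ‖x - y‖ ≤ Real.log (Real.sqrt n) + Real.log r := by
      rw [← Real.log_mul hsn0.ne' hr.ne']
      exact Real.log_le_log hpos hd
    have h6 : Real.log (Real.sqrt n) ≤ Real.log (4 * n) / 2 := by
      rw [Real.log_sqrt (by linarith)]
      have : Real.log n ≤ Real.log (4 * n) := Real.log_le_log (by linarith) (by linarith)
      linarith
    have h7 : -Real.log r / 2 ≤ -Real.log ‖x - y‖ := by linarith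
    have h8 : 0 < -Real.log r := by linarith
    have h9 : |p x - p y| ≤ c / (-Real.log r / 2) :=
      hb.trans (by gcongr)
    have : |p x - p y| * -Real.log r ≤ 2 * c := by
      calc _ ≤ c / (-Real.log r / 2) * -Real.log r := by gcongr
        _ = 2 * c := by
          have h8' := h8.ne'
          generalize -Real.log r = t at h8'
          field_simp
    nlinarith
  · push Not at hrs
    have h1 : -Real.log r ≤ Real.log (4 * n) := by
      rw [← Real.log_inv]
      apply Real.log_le_log (by positivity)
      rw [inv_le_comm₀ hr (by positivity), ← one_div]; exact hrs.le
    have h2 : |p x - p y| ≤ pp := by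
      rw [abs_le]; constructor <;> linarith [hpmle x, hple x, hpmle y, hple y]
    have h3 : |p x - p y| * -Real.log r ≤ pp * Real.log (4 * n) := by
      apply mul_le_mul h2 h1 (by linarith) hpp.le
    linarith

theorem pinf_bounds {n : ℕ} (hn : 0 < n) (p : Rn n → ℝ) (C pinf : ℝ) (hC : 0 < C)
    (h : ∀ x : Rn n, |p x - pinf| ≤ C / Real.log (Real.exp 1 + ‖x‖))
    (pm pp : ℝ) (hpmle : ∀ x, pm ≤ p x) (hple : ∀ x, p x ≤ pp) : pm ≤ pinf ∧ pinf ≤ pp := by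
  have key : ∀ δ > 0, ∃ x : Rn n, |p x - pinf| ≤ δ := by
    intro δ hδ
    refine ⟨EuclideanSpace.single ⟨0, hn⟩ (Real.exp (C / δ)), (h _).trans ?_⟩
    have h1 : ‖(EuclideanSpace.single (⟨0, hn⟩ : Fin n) (Real.exp (C / δ)) : Rn n)‖ = Real.exp (C / δ) := by
      simp
    rw [h1]
    have h2 : C / δ ≤ Real.log (Real.exp 1 + Real.exp (C / δ)) := by
      rw [Real.le_log_iff_exp_le (by positivity)]
      linarith [Real.exp_pos 1]
    have h3 : 0 < C / δ := by positivity
    rw [div_le_iff₀ (by linarith)]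
    rw [div_le_iff₀ hδ] at h2
    linarith
  constructor
  · apply _root_.le_of_forall_pos_le_add
    intro δ hδ
    obtain ⟨x, hx⟩ := key δ hδ
    linarith [(abs_le.mp hx).2, hpmle x]
  · apply _root_.le_of_forall_pos_le_add
    intro δ hδ
    obtain ⟨x, hx⟩ := key δ hδ
    linarith [(abs_le.mp hx).1, hple x]

theorem lower_mu {n : ℕ} (p : Rn n → ℝ) (pm : ℝ) (hpm : 0 < pm) (hpmle : ∀ x, pm ≤ p x)
    (E : ℝ) (hE : 0 ≤ E) :
    ∃ c > 0, c ≤ 1 ∧ ∀ (z : Rn n) (r μ P : ℝ) (S : Set (Rn n)), 0 < r → 0 < μ → pm ≤ P →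
      MeasurableSet S → S ⊆ cube z r → ENNReal.ofReal (r ^ n / 2) ≤ volume S →
      (∀ x ∈ S, |p x - P| * |Real.log r| ≤ E) →
      (∫⁻ x in cube z r, ENNReal.ofReal (μ ^ (-(p x)))) ≤ 1 → c * r ^ (n / P) ≤ μ := by
  set B : ℝ := 4 * Real.exp (n * E / pm) with hB
  have hB1 : 1 ≤ B := by
    have : 1 ≤ Real.exp (n * E / pm) := Real.one_le_exp (by positivity)
    linarith
  have hB0 : 0 < B := by linarith
  refine ⟨B ^ (-(1 / pm)), by positivity, ?_, ?_⟩
  · apply Real.rpow_le_one_of_one_le_of_nonpos hB1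
    rw [neg_nonpos]; positivity
  intro z r μ P S hr hμ hP hS hSQ hvol hosc hmod
  by_contra hcon
  push Not at hcon
  have hP0 : 0 < P := by linarith
  have hpt : ∀ x ∈ S, 4 * (r ^ n)⁻¹ ≤ μ ^ (-(p x)) := by
    intro x hx
    have hpx : 0 < p x := lt_of_lt_of_le hpm (hpmle x)
    have h1 : (B ^ (-(1 / pm)) * r ^ ((n:ℝ) / P)) ^ (-(p x)) ≤ μ ^ (-(p x)) :=
      Real.rpow_le_rpow_of_nonpos hμ hcon.le (by linarith)
    refine le_trans ?_ h1
    rw [Real.mul_rpow (by positivity) (by positivity), ← Real.rpow_mul hB0.le, ← Real.rpow_mul hr.le]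
    have h2 : B ≤ B ^ (-(1 / pm) * -p x) := by
      conv_lhs => rw [← Real.rpow_one B]
      apply Real.rpow_le_rpow_of_exponent_le hB1
      rw [neg_mul_neg, one_div, ← div_eq_inv_mul, le_div_iff₀ hpm, one_mul]
      exact hpmle x
    have h3 : Real.exp (-(n * E / pm)) * (r ^ n)⁻¹ ≤ r ^ ((n:ℝ) / P * -p x) := by
      have e1 : (n:ℝ) / P * -p x = -(n:ℝ) + (-((n:ℝ) / P * (p x - P))) := by
        field_simp; ring
      rw [e1, Real.rpow_add hr, Real.rpow_neg hr.le, Real.rpow_natCast, mul_comm]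
      gcongr
      rw [Real.rpow_def_of_pos hr]
      apply Real.exp_le_exp.mpr
      have h4 := hosc x hx
      rw [← abs_mul] at h4
      have h5 := (abs_le.mp h4).2
      have h6 : Real.log r * -((n:ℝ) / P * (p x - P)) = -((n:ℝ) / P * ((p x - P) * Real.log r)) := by ring
      rw [h6, neg_le_neg_iff]
      calc (n:ℝ) / P * ((p x - P) * Real.log r) ≤ n / P * E := by gcongr
        _ ≤ n / pm * E := by gcongr
        _ = _ := by ring
    calc 4 * (r ^ n)⁻¹ = B * (Real.exp (-(n * E / pm)) * (r ^ n)⁻¹) := by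
          rw [hB, Real.exp_neg]; field_simp
      _ ≤ _ := by gcongr
  have hlow : ENNReal.ofReal (4 * (r ^ n)⁻¹) * volume S ≤ 1 := by
    rw [← setLIntegral_const]
    refine le_trans ?_ hmod
    refine le_trans ?_ (lintegral_mono_set hSQ)
    apply setLIntegral_mono' hS
    intro x hx
    exact ENNReal.ofReal_le_ofReal (hpt x hx)
  have h2 : ENNReal.ofReal 2 ≤ 1 := by
    refine le_trans ?_ hlow
    calc ENNReal.ofReal 2 = ENNReal.ofReal (4 * (r ^ n)⁻¹) * ENNReal.ofReal (r ^ n / 2) := by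
          rw [← ENNReal.ofReal_mul (by positivity)]
          congr 1; field_simp; norm_num
      _ ≤ _ := by gcongr
  rw [ENNReal.ofReal_le_one] at h2
  norm_num at h2


theorem large_set {n : ℕ} (hn : 0 < n) (z : Rn n) (r : ℝ) (hr : 0 < r) :
    ENNReal.ofReal (r ^ n / 2) ≤ volume (cube z r \ cube 0 (r / 2)) := by
  refine le_trans ?_ le_measure_sdiff
  rw [cube_volume z r hr.le, cube_volume 0 (r/2) (by positivity), ← ENNReal.ofReal_sub _ (by positivity)]
  apply ENNReal.ofReal_le_ofReal
  rw [div_pow]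
  have h1 : (2:ℝ) ≤ 2 ^ n := by
    calc (2:ℝ) = 2 ^ 1 := by norm_num
      _ ≤ 2 ^ n := pow_le_pow_right₀ (by norm_num) hn
  have h2 : r ^ n / 2 ^ n ≤ r ^ n / 2 := by gcongr
  linarith

theorem not_mem_cube0 {n : ℕ} {x : Rn n} {t : ℝ} (hx : x ∉ cube 0 t) : t / 2 ≤ ‖x‖ := by
  simp only [cube, Set.mem_ofPred_eq, not_forall, not_le] at hx
  obtain ⟨i, hi⟩ := hx
  have := PiLp.norm_apply_le x i
  simp only [PiLp.zero_apply, sub_zero] at hi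
  rw [Real.norm_eq_abs] at this
  linarith

theorem mod_compare {n : ℕ} (hn : 0 < n) (α : ℝ) (hα0 : 0 < α)
    (p q : Rn n → ℝ) (hploc : LogHolderLocal p) (hpinf : LogHolderInfty p)
    (pm pp : ℝ) (hpm : 0 < pm) (hpmle : ∀ x, pm ≤ p x) (hple : ∀ x, p x ≤ pp)
    (hpp : pp * α < n) (hq : ∀ x, 1 / q x = 1 / p x - α / n)
    (Q : ℝ) (hqm : ∀ x, pm ≤ q x) (hqQ : ∀ x, q x ≤ Q) :
    ∃ K, 1 ≤ K ∧ ∀ (z : Rn n) (r μ : ℝ), 0 < r → 0 < μ →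
      (∫⁻ x in cube z r, ENNReal.ofReal (μ ^ (-(p x)))) ≤ 1 →
      (∫⁻ x in cube z r, ENNReal.ofReal ((r ^ (-α) * μ) ^ (-(q x)))) ≤ ENNReal.ofReal K := by
  have hn0 : (0:ℝ) < n := by exact_mod_cast hn
  obtain ⟨L, hL, hosc⟩ := osc_small hn p hploc pm pp hpm hpmle hple
  obtain ⟨C, hC, pinf, hinf⟩ := hpinf
  obtain ⟨hpi1, hpi2⟩ := pinf_bounds hn p C pinf hC hinf pm pp hpmle hple
  have hpi0 : 0 < pinf := by linarith
  have hQ0 : 0 < Q := lt_of_lt_of_le hpm ((hqm 0).trans (hqQ 0))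
  obtain ⟨c, hc, hc1, hlow⟩ := lower_mu p pm hpm hpmle (L + 2 * C) (by positivity)
  set b : ℝ := n / pinf - α with hb
  have hb0 : 0 < b := by
    rw [hb, sub_pos, lt_div_iff₀ hpi0]
    nlinarith
  set ε : ℝ := b * pm / n with hε
  have hε0 : 0 < ε := by positivity
  set E : ℝ := n * Q / (pm * pm) * (C / ε) with hE
  have hE0 : 0 ≤ E := by positivity
  have hcQ : 1 ≤ c ^ (-Q) := Real.one_le_rpow_of_pos_of_le_one_of_nonpos hc hc1 (by linarith)
  have hEe : 1 ≤ Real.exp E := Real.one_le_exp hE0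
  refine ⟨c ^ (-Q) * (Real.exp E + 2 ^ n), ?_, ?_⟩
  · have : (0:ℝ) < 2 ^ n := by positivity
    nlinarith
  intro z r μ hr hμ hmod
  have hrn : 0 < r ^ n := by positivity
  have hcq : ∀ x, c ^ (-(q x)) ≤ c ^ (-Q) := fun x =>
    Real.rpow_le_rpow_of_exponent_ge hc hc1 (by linarith [hqQ x])
  have hpx : ∀ x, 0 < p x := fun x => lt_of_lt_of_le hpm (hpmle x)
  have hqx : ∀ x, 0 < q x := fun x => lt_of_lt_of_le hpm (hqm x)
  have hid : ∀ x, (n / p x - α) * q x = n := by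
    intro x
    have h := hq x
    have h1 := (hpx x).ne'
    have h2 := (hqx x).ne'
    have : n / p x - α = n * (1 / q x) := by rw [h]; field_simp
    rw [this]; field_simp
  -- generic pointwise step
  have hgen : ∀ x (P : ℝ), c * r ^ (n / P) ≤ μ →
      (r ^ (-α) * μ) ^ (-(q x)) ≤ c ^ (-Q) * r ^ (-((n / P - α) * q x)) := by
    intro x P hP
    have h1 : c * r ^ (n / P - α) ≤ r ^ (-α) * μ := by
      calc c * r ^ (n / P - α) = r ^ (-α) * (c * r ^ (n / P)) := by
            rw [sub_eq_add_neg, Real.rpow_add hr]; ring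
        _ ≤ _ := by gcongr
    calc _ ≤ (c * r ^ (n / P - α)) ^ (-(q x)) :=
          Real.rpow_le_rpow_of_nonpos (by positivity) h1 (by linarith [hqx x])
      _ = c ^ (-(q x)) * r ^ (-((n / P - α) * q x)) := by
          rw [Real.mul_rpow hc.le (by positivity), ← Real.rpow_mul hr.le]
          congr 2; ring
      _ ≤ _ := mul_le_mul_of_nonneg_right (hcq x) (by positivity)
  rcases le_total r 1 with hr1 | hr1
  · have hpt : ∀ x ∈ cube z r, (r ^ (-α) * μ) ^ (-(q x)) ≤ c ^ (-Q) * (r ^ n)⁻¹ := by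
      intro x hx
      have h1 := hlow z r μ (p x) (cube z r) hr hμ (hpmle x) (cube_measurable z r) subset_rfl
        (by rw [cube_volume z r hr.le]; apply ENNReal.ofReal_le_ofReal; linarith)
        (fun y hy => by linarith [hosc z r hr hr1 y hy x hx]) hmod
      have h2 := hgen x (p x) h1
      rwa [hid x, Real.rpow_neg hr.le (n:ℝ), Real.rpow_natCast] at h2
    calc _ ≤ ∫⁻ x in cube z r, ENNReal.ofReal (c ^ (-Q) * (r ^ n)⁻¹) := by
          apply setLIntegral_mono' (cube_measurable z r)
          intro x hx
          exact ENNReal.ofReal_le_ofReal (hpt x hx)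
      _ = ENNReal.ofReal (c ^ (-Q)) := by
          rw [setLIntegral_const, cube_volume z r hr.le, ← ENNReal.ofReal_mul (by positivity)]
          congr 1; field_simp
      _ ≤ _ := by
          apply ENNReal.ofReal_le_ofReal
          have : (0:ℝ) < 2 ^ n := by positivity
          nlinarith
  · have hlog : 0 ≤ Real.log r := Real.log_nonneg hr1
    have hmu := hlow z r μ pinf (cube z r \ cube 0 (r / 2)) hr hμ hpi1
        ((cube_measurable z r).diff (cube_measurable 0 (r/2))) Set.sdiff_subset (large_set hn z r hr)
        (fun x hx => by
          have h1 := not_mem_cube0 hx.2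
          have h2 : Real.log r / 2 ≤ Real.log (Real.exp 1 + ‖x‖) := by
            rw [← Real.log_sqrt hr.le]
            apply Real.log_le_log (Real.sqrt_pos.mpr hr)
            have e2 : 1 ≤ Real.exp 1 := Real.one_le_exp (by norm_num)
            rw [Real.sqrt_le_left (by positivity)]
            nlinarith [norm_nonneg x, sq_nonneg (1 - ‖x‖), sq_nonneg (Real.exp 1 - ‖x‖)]
          have h4 : 0 < Real.log (Real.exp 1 + ‖x‖) := by
            apply Real.log_pos
            have : 1 < Real.exp 1 := Real.one_lt_exp_iff.mpr (by norm_num)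
            linarith [norm_nonneg x]
          have h3 := hinf x
          rw [le_div_iff₀ h4] at h3
          rw [abs_of_nonneg hlog]
          have := abs_nonneg (p x - pinf)
          nlinarith) hmod
    have hpt : ∀ x, (r ^ (-α) * μ) ^ (-(q x)) ≤ c ^ (-Q) * (Real.exp E * (r ^ n)⁻¹) +
        (cube 0 (2 * r ^ ε)).indicator (fun _ => c ^ (-Q) * ((r ^ ε) ^ n)⁻¹) x := by
      intro x
      have h1 := hgen x pinf hmu
      rw [← hb] at h1
      refine h1.trans ?_
      by_cases hx : x ∈ cube 0 (2 * r ^ ε)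
      · rw [Set.indicator_of_mem hx]
        have : r ^ (-(b * q x)) ≤ ((r ^ ε) ^ n)⁻¹ := by
          rw [← Real.rpow_natCast, ← Real.rpow_mul hr.le, ← Real.rpow_neg hr.le]
          apply Real.rpow_le_rpow_of_exponent_le hr1
          have : ε * n = b * pm := by rw [hε]; field_simp
          rw [this, neg_le_neg_iff]
          have := hqm x
          gcongr
        have h3 : 0 ≤ c ^ (-Q) * (Real.exp E * (r ^ n)⁻¹) := by positivity
        have h4 : c ^ (-Q) * r ^ (-(b * q x)) ≤ c ^ (-Q) * ((r ^ ε) ^ n)⁻¹ := by gcongr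
        linarith
      · rw [Set.indicator_of_notMem hx, add_zero]
        gcongr
        have h2 := not_mem_cube0 hx
        have h2' : r ^ ε ≤ ‖x‖ := by linarith
        have h3 : ε * Real.log r ≤ Real.log (Real.exp 1 + ‖x‖) := by
          rw [← Real.log_rpow hr]
          apply Real.log_le_log (by positivity)
          linarith [Real.exp_pos 1]
        have h4 : 0 < Real.log (Real.exp 1 + ‖x‖) := by
          apply Real.log_pos
          have : 1 < Real.exp 1 := Real.one_lt_exp_iff.mpr (by norm_num)
          linarith [norm_nonneg x]
        have h5 := hinf x
        rw [le_div_iff₀ h4] at h5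
        have h6 : |p x - pinf| * Real.log r ≤ C / ε := by
          rw [le_div_iff₀ hε0]
          have := abs_nonneg (p x - pinf)
          nlinarith
        have e1 : -(b * q x) = -(n:ℝ) + -(n * q x / (p x * pinf) * (p x - pinf)) := by
          have hh := hid x
          have h1 := (hpx x).ne'
          have : b = (n / p x - α) + n * (p x - pinf) / (p x * pinf) := by
            rw [hb]; field_simp; ring
          rw [this, add_mul, hh]; ring
        rw [e1, Real.rpow_add hr, Real.rpow_neg hr.le (n:ℝ), Real.rpow_natCast, mul_comm]
        gcongr
        rw [Real.rpow_def_of_pos hr]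
        apply Real.exp_le_exp.mpr
        have hp1 := hpx x
        have hq1 := hqx x
        calc Real.log r * -(n * q x / (p x * pinf) * (p x - pinf))
            = n * q x / (p x * pinf) * (-(p x - pinf) * Real.log r) := by ring
          _ ≤ n * q x / (p x * pinf) * (C / ε) := by
              gcongr
              refine le_trans ?_ h6
              gcongr
              exact neg_le_abs _
          _ ≤ E := by
              rw [hE]
              have := hqQ x
              have := hpmle x
              gcongr
    have hnn : ∀ x : Rn n, 0 ≤ (cube 0 (2 * r ^ ε)).indicator (fun _ => c ^ (-Q) * ((r ^ ε) ^ n)⁻¹) x :=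
      fun x => Set.indicator_nonneg (fun _ _ => by positivity) x
    calc _ ≤ ∫⁻ x in cube z r, (ENNReal.ofReal (c ^ (-Q) * (Real.exp E * (r ^ n)⁻¹)) +
          (cube 0 (2 * r ^ ε)).indicator (fun _ => ENNReal.ofReal (c ^ (-Q) * ((r ^ ε) ^ n)⁻¹)) x) := by
          apply lintegral_mono
          intro x
          refine (ENNReal.ofReal_le_ofReal (hpt x)).trans ?_
          rw [ENNReal.ofReal_add (by positivity) (hnn x)]
          refine add_le_add le_rfl ?_
          by_cases hx : x ∈ cube 0 (2 * r ^ ε)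
          · rw [Set.indicator_of_mem hx, Set.indicator_of_mem hx]
          · rw [Set.indicator_of_notMem hx, Set.indicator_of_notMem hx]; simp
      _ ≤ ENNReal.ofReal (c ^ (-Q) * (Real.exp E * (r ^ n)⁻¹)) * volume (cube z r) +
          ENNReal.ofReal (c ^ (-Q) * ((r ^ ε) ^ n)⁻¹) * volume (cube (0 : Rn n) (2 * r ^ ε)) := by
          rw [lintegral_add_left measurable_const, setLIntegral_const]
          gcongr
          refine (setLIntegral_le_lintegral _ _).trans ?_
          rw [lintegral_indicator (cube_measurable _ _), setLIntegral_const]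
      _ = _ := by
          have hre : 0 < r ^ ε := by positivity
          rw [cube_volume z r hr.le, cube_volume 0 _ (by positivity), ← ENNReal.ofReal_mul (by positivity),
            ← ENNReal.ofReal_mul (by positivity), ← ENNReal.ofReal_add (by positivity) (by positivity)]
          congr 1
          rw [mul_pow]
          field_simp

theorem norm_compare {n : ℕ} (hn : 0 < n) (α : ℝ) (hα0 : 0 < α)
    (p q : Rn n → ℝ) (hploc : LogHolderLocal p) (hpinf : LogHolderInfty p)
    (pm pp : ℝ) (hpm : 0 < pm) (hpmle : ∀ x, pm ≤ p x) (hple : ∀ x, p x ≤ pp)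
    (hpp : pp * α < n) (hq : ∀ x, 1 / q x = 1 / p x - α / n)
    (Q : ℝ) (hqm : ∀ x, pm ≤ q x) (hqQ : ∀ x, q x ≤ Q) :
    ∃ K > 0, ∀ (z : Rn n) (r : ℝ), 0 < r →
      varLpNorm q (cubeInd z r) ≤ ENNReal.ofReal (K * r ^ (-α)) * varLpNorm p (cubeInd z r) := by
  obtain ⟨K, hK1, hK⟩ := mod_compare hn α hα0 p q hploc hpinf pm pp hpm hpmle hple hpp hq Q hqm hqQ
  have hK0 : 0 < K := by linarith
  have hpx : ∀ x, 0 < p x := fun x => lt_of_lt_of_le hpm (hpmle x)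
  have hqx : ∀ x, 0 < q x := fun x => lt_of_lt_of_le hpm (hqm x)
  refine ⟨K ^ (1 / pm), by positivity, ?_⟩
  intro z r hr
  have hA : 0 < K ^ (1 / pm) * r ^ (-α) := by positivity
  rw [mul_comm, ← ENNReal.div_le_iff_le_mul (Or.inl (by simpa using hA)) (Or.inl ENNReal.ofReal_ne_top)] 
  · unfold varLpNorm
    conv_rhs => unfold varLpNormE
    apply le_sInf
    rintro l ⟨μ, hμ, rfl, hmod⟩
    rw [ENNReal.div_le_iff_le_mul (Or.inl (by simpa using hA)) (Or.inl ENNReal.ofReal_ne_top),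
      ← ENNReal.ofReal_mul hμ.le]
    rw [modular_eq p hpx z r μ hμ] at hmod
    unfold varLpNormE
    apply sInf_le
    refine ⟨μ * (K ^ (1 / pm) * r ^ (-α)), by positivity, rfl, ?_⟩
    rw [modular_eq q hqx z r _ (by positivity)]
    calc _ ≤ ∫⁻ x in cube z r, ENNReal.ofReal K⁻¹ * ENNReal.ofReal ((r ^ (-α) * μ) ^ (-(q x))) := by
          apply lintegral_mono
          intro x
          dsimp only
          rw [← ENNReal.ofReal_mul (by positivity)]
          apply ENNReal.ofReal_le_ofReal
          have e : μ * (K ^ (1 / pm) * r ^ (-α)) = K ^ (1 / pm) * (r ^ (-α) * μ) := by ring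
          rw [e, Real.mul_rpow (by positivity) (by positivity)]
          gcongr
          rw [← Real.rpow_mul hK0.le, ← Real.rpow_neg_one]
          apply Real.rpow_le_rpow_of_exponent_le hK1
          rw [mul_neg, neg_le_neg_iff, one_div, ← div_eq_inv_mul, le_div_iff₀ hpm, one_mul]
          exact hqm x
      _ = ENNReal.ofReal K⁻¹ * ∫⁻ x in cube z r, ENNReal.ofReal ((r ^ (-α) * μ) ^ (-(q x))) := by
          rw [lintegral_const_mul' _ _ ENNReal.ofReal_ne_top]
      _ ≤ ENNReal.ofReal K⁻¹ * ENNReal.ofReal K := by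
          gcongr
          exact hK z r μ hr hμ hmod
      _ = 1 := by
          rw [← ENNReal.ofReal_mul (by positivity), inv_mul_cancel₀ hK0.ne', ENNReal.ofReal_one]

theorem norm_pos' {n : ℕ} (q : Rn n → ℝ) (pm : ℝ) (hpm : 0 < pm) (hqm : ∀ x, pm ≤ q x)
    (z : Rn n) (r : ℝ) (hr : 0 < r) : varLpNorm q (cubeInd z r) ≠ 0 := by
  have hqx : ∀ x, 0 < q x := fun x => lt_of_lt_of_le hpm (hqm x)
  set c : ℝ := min 1 ((r ^ n) ^ (1 / pm)) with hc
  have hc0 : 0 < c := by positivity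
  have hle : ENNReal.ofReal c ≤ varLpNorm q (cubeInd z r) := by
    unfold varLpNorm varLpNormE
    apply le_sInf
    rintro l ⟨μ, hμ, rfl, hmod⟩
    rw [modular_eq q hqx z r μ hμ] at hmod
    apply ENNReal.ofReal_le_ofReal
    rcases le_total 1 μ with h1 | h1
    · exact (min_le_left _ _).trans h1
    · refine (min_le_right _ _).trans ?_
      have h2 : ENNReal.ofReal (μ ^ (-pm)) * volume (cube z r) ≤ 1 := by
        rw [← setLIntegral_const]
        refine le_trans (lintegral_mono fun x => ?_) hmod
        apply ENNReal.ofReal_le_ofReal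
        exact Real.rpow_le_rpow_of_exponent_ge hμ h1 (by linarith [hqm x])
      rw [cube_volume z r hr.le, ← ENNReal.ofReal_mul (by positivity), ENNReal.ofReal_le_one,
        Real.rpow_neg hμ.le, inv_mul_le_iff₀ (by positivity), mul_one] at h2
      calc (r ^ n) ^ (1 / pm) ≤ (μ ^ pm) ^ (1 / pm) := by gcongr
        _ = μ := by rw [← Real.rpow_mul hμ.le, mul_one_div_cancel hpm.ne', Real.rpow_one]
  intro h0
  rw [h0] at hle
  simp at hle
  linarith

theorem riesz_atom_decay_bound
    {n : ℕ} (hn : 0 < n)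
    (α : ℝ) (hα0 : 0 < α) (hαn : α < n)
    (p q : Rn n → ℝ) (hploc : LogHolderLocal p) (hpinf : LogHolderInfty p)
    (pm pp : ℝ) (hpm : 0 < pm) (hpmle : ∀ x, pm ≤ p x) (hple : ∀ x, p x ≤ pp)
    (hpp : pp * α < n)
    (hq : ∀ x, 1 / q x = 1 / p x - α / n)
    (p₀ : ℝ) (hp₀1 : 1 < p₀) (hp₀p : pp < p₀) (hp₀n : p₀ * α < n)
    (d : ℕ) (hd : dIndex n (pLow p) ≤ d)
    (hd2 : 2 * (n : ℝ) + 2 * (dIndex n (pLow q) : ℝ) + 3 ≤ (n : ℝ) - α + d + 1) :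
    ∃ C > 0, ∀ (a : Rn n → ℝ) (z : Rn n) (r : ℝ), 0 < r → IsPAtom p p₀ d a z r →
      ∀ x ∉ cube z (2 * Real.sqrt n * r),
      |riesz α a x| ≤ C * (varLpNorm q (cubeInd z r)).toReal⁻¹ *
        (1 + ‖x - z‖ / r) ^ (-(2 * (n : ℝ) + 2 * (dIndex n (pLow q) : ℝ) + 3)) := by
  have hn0 : (0:ℝ) < n := by exact_mod_cast hn
  have hn1 : (1:ℝ) ≤ n := by exact_mod_cast hn
  have hpx : ∀ x, 0 < p x := fun x => lt_of_lt_of_le hpm (hpmle x)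
  have hpp0 : 0 < pp := lt_of_lt_of_le (hpx 0) (hple 0)
  set β : ℝ := 1 / pp - α / n with hβ
  have hβ0 : 0 < β := by
    rw [hβ, sub_pos, div_lt_div_iff₀ hn0 hpp0]
    linarith
  have hqβ : ∀ x, β ≤ 1 / q x := by
    intro x
    rw [hq x, hβ]
    have := one_div_le_one_div_of_le (hpx x) (hple x)
    linarith
  have hqx : ∀ x, 0 < q x := fun x => one_div_pos.mp (lt_of_lt_of_le hβ0 (hqβ x))
  have hqQ : ∀ x, q x ≤ 1 / β := by
    intro x
    rw [le_one_div (hqx x) hβ0]; exact hqβ x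
  have hqm : ∀ x, pm ≤ q x := by
    intro x
    rw [← one_div_le_one_div (hqx x) hpm, hq x]
    have := one_div_le_one_div_of_le hpm (hpmle x)
    have : 0 < α / n := by positivity
    linarith
  obtain ⟨K, hK0, hK⟩ := norm_compare hn α hα0 p q hploc hpinf pm pp hpm hpmle hple hpp hq
    (1 / β) hqm hqQ
  obtain ⟨C, hC0, hC⟩ := riesz_bound hn (α - n) d
  set M : ℝ := 2 * (n : ℝ) + 2 * (dIndex n (pLow q) : ℝ) + 3 with hM
  have hM0 : 0 < M := by positivity
  refine ⟨C * K * 2 ^ M, by positivity, ?_⟩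
  intro a z r hr h x hx
  have hNp := norm_pos' p pm hpm hpmle z r hr
  have hNq := norm_pos' q pm hpm hqm z r hr
  have hcmp := hK z r hr
  have hl1 := atom_l1 hp₀1 hr h
  set Np := varLpNorm p (cubeInd z r) with hNpd
  set Nq := varLpNorm q (cubeInd z r) with hNqd
  have hA : 0 < K * r ^ (-α) := by positivity
  have hinv : Np⁻¹ ≤ ENNReal.ofReal (K * r ^ (-α)) * Nq⁻¹ := by
    have h1 : (ENNReal.ofReal (K * r ^ (-α)) * Np)⁻¹ ≤ Nq⁻¹ := ENNReal.inv_le_inv.mpr hcmp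
    rw [ENNReal.mul_inv (Or.inl (by simpa using hA)) (Or.inl ENNReal.ofReal_ne_top)] at h1
    calc Np⁻¹ = ENNReal.ofReal (K * r ^ (-α)) * ((ENNReal.ofReal (K * r ^ (-α)))⁻¹ * Np⁻¹) := by
          rw [← mul_assoc, ENNReal.mul_inv_cancel (by simpa using hA) ENNReal.ofReal_ne_top, one_mul]
      _ ≤ _ := by gcongr
  have hl2 : eLpNorm a 1 volume ≤
      ENNReal.ofReal (r ^ n) * (ENNReal.ofReal (K * r ^ (-α)) * Nq⁻¹) := by
    refine hl1.trans ?_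
    rw [div_eq_mul_inv]
    gcongr
  have hfin : ENNReal.ofReal (r ^ n) * (ENNReal.ofReal (K * r ^ (-α)) * Nq⁻¹) ≠ ⊤ :=
    ENNReal.mul_ne_top ENNReal.ofReal_ne_top
      (ENNReal.mul_ne_top ENNReal.ofReal_ne_top (ENNReal.inv_ne_top.mpr hNq))
  have hai : Integrable a := by
    rw [← memLp_one_iff_integrable]
    exact ⟨h.measurable.aestronglyMeasurable, lt_of_le_of_lt hl2 hfin.lt_top⟩
  have hl3 : ∫ y, ‖a y‖ ≤ r ^ n * (K * r ^ (-α) * Nq.toReal⁻¹) := by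
    rw [integral_norm_eq_lintegral_enorm hai.1, ← eLpNorm_one_eq_lintegral_enorm]
    refine (ENNReal.toReal_mono hfin hl2).trans (le_of_eq ?_)
    rw [ENNReal.toReal_mul, ENNReal.toReal_mul, ENNReal.toReal_inv,
      ENNReal.toReal_ofReal (by positivity), ENNReal.toReal_ofReal hA.le]
  have hfinal := hC p p₀ a z r hr h hai x hx
  have hR := not_mem_cube hx
  have hsn : 1 ≤ Real.sqrt n := by
    rw [Real.one_le_sqrt]; exact hn1
  set R := ‖x - z‖ with hRd
  have hrR : r ≤ R := by nlinarith
  have hR0 : 0 < R := by linarith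
  set T := R / r with hT
  have hT1 : 1 ≤ T := by rw [hT, le_div_iff₀ hr]; linarith
  have hT0 : 0 < T := by linarith
  have hRT : R = T * r := by rw [hT]; field_simp
  have hpow : R ^ (α - (n:ℝ)) * (r / R) ^ (d + 1) * (r ^ n * r ^ (-α)) ≤ 2 ^ M * (1 + T) ^ (-M) := by
    have e1 : r / R = T⁻¹ := by rw [hT, inv_div]
    have e2 : (T⁻¹) ^ (d + 1) = T ^ (-((d:ℝ) + 1)) := by
      rw [Real.rpow_neg hT0.le, inv_pow, ← Real.rpow_natCast]; push_cast; rfl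
    have e3 : r ^ n * r ^ (-α) = r ^ ((n:ℝ) + -α) := by
      rw [Real.rpow_add hr, Real.rpow_natCast]
    have e4 : R ^ (α - (n:ℝ)) = T ^ (α - (n:ℝ)) * r ^ (α - (n:ℝ)) := by
      rw [hRT, Real.mul_rpow hT0.le hr.le]
    have e5 : r ^ (α - (n:ℝ)) * r ^ ((n:ℝ) + -α) = 1 := by
      rw [← Real.rpow_add hr]
      have : α - (n:ℝ) + ((n:ℝ) + -α) = 0 := by ring
      rw [this, Real.rpow_zero]
    calc R ^ (α - (n:ℝ)) * (r / R) ^ (d + 1) * (r ^ n * r ^ (-α))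
        = (T ^ (α - (n:ℝ)) * T ^ (-((d:ℝ) + 1))) * (r ^ (α - (n:ℝ)) * r ^ ((n:ℝ) + -α)) := by
          rw [e1, e2, e3, e4]; ring
      _ = T ^ (α - (n:ℝ) + -((d:ℝ) + 1)) := by rw [e5, mul_one, Real.rpow_add hT0]
      _ ≤ T ^ (-M) := by
          apply Real.rpow_le_rpow_of_exponent_le hT1
          linarith
      _ ≤ ((1 + T) / 2) ^ (-M) := by
          apply Real.rpow_le_rpow_of_nonpos (by positivity) (by linarith) (by linarith)
      _ = 2 ^ M * (1 + T) ^ (-M) := by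
          rw [Real.div_rpow (by positivity) (by norm_num), Real.rpow_neg (by norm_num : (0:ℝ) ≤ 2),
            div_inv_eq_mul, mul_comm]
  unfold riesz
  have hNi : 0 ≤ Nq.toReal⁻¹ := inv_nonneg.mpr ENNReal.toReal_nonneg
  calc _ ≤ _ := hfinal
    _ ≤ C * (R ^ (α - (n:ℝ)) * (r / R) ^ (d + 1)) * (r ^ n * (K * r ^ (-α) * Nq.toReal⁻¹)) := by
        gcongr
    _ = C * K * Nq.toReal⁻¹ * (R ^ (α - (n:ℝ)) * (r / R) ^ (d + 1) * (r ^ n * r ^ (-α))) := by ring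
    _ ≤ C * K * Nq.toReal⁻¹ * (2 ^ M * (1 + T) ^ (-M)) := by
        apply mul_le_mul_of_nonneg_left hpow
        positivity
    _ = _ := by ring
end

section
/- Let 0 < α < n and let s ∈ ℕ∪{0}. Let a be a bounded measurable function supported in a cube Q such that ∫ a(x) x^γ dx = 0 for all multi-indices |γ| ≤ d, where d is an integer with d ≥ 2s + 2 + α + n. Then for every multi-index β with |β| ≤ s, the integral ∫_{ℝⁿ} x^β I_α a(x) dx is absolutely convergent and equals 0, where I_α a(x) = ∫_{ℝⁿ} |x−y|^{α−n} a(y) dy is the Riesz potential of a. -/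
open MeasureTheory ENNReal

section RA

open scoped ContDiff

lemma ra_int_mul {n : ℕ} (a : Rn n → ℝ) (ha : Measurable a) (M : ℝ) (haM : ∀ x, |a x| ≤ M)
    (ρ : ℝ) (hρ : ∀ x, ρ < ‖x‖ → a x = 0) (g : Rn n → ℝ) (hg : Continuous g) :
    Integrable (fun y => g y * a y) := by
  obtain ⟨C, hC⟩ := (isCompact_closedBall (0 : Rn n) ρ).exists_bound_of_continuousOn hg.continuousOn
  have hM : 0 ≤ M := (abs_nonneg _).trans (haM 0)
  have h1 : Integrable ((Metric.closedBall (0 : Rn n) ρ).indicator (fun _ => C * M)) :=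
    (integrable_indicator_iff Metric.isClosed_closedBall.measurableSet).2
      (integrableOn_const (isCompact_closedBall _ _).measure_lt_top.ne)
  refine h1.mono' (hg.measurable.mul ha).aestronglyMeasurable (Filter.Eventually.of_forall fun y => ?_)
  by_cases hy : y ∈ Metric.closedBall (0 : Rn n) ρ
  · rw [Set.indicator_of_mem hy, norm_mul]
    have := hC y hy
    exact mul_le_mul this (haM y) (norm_nonneg _) ((norm_nonneg _).trans this)
  · rw [Set.indicator_of_notMem hy]
    have : a y = 0 := hρ y (by simpa using hy)
    simp [this]

lemma ra_poly {n : ℕ} (d : ℕ) (a : Rn n → ℝ) (ha : Measurable a) (M : ℝ) (haM : ∀ x, |a x| ≤ M)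
    (ρ : ℝ) (hρ : ∀ x, ρ < ‖x‖ → a x = 0)
    (hmom : ∀ γ : Fin n → ℕ, (∑ i, γ i) ≤ d → ∫ x, a x * ∏ i, x i ^ γ i = 0)
    (k : ℕ) (hk : k ≤ d) (T : ContinuousMultilinearMap ℝ (fun _ : Fin k => Rn n) ℝ) :
    ∫ y, T (fun _ => y) * a y = 0 := by
  have hT : ∀ y : Rn n, T (fun _ => y) =
      ∑ f : Fin k → Fin n, (∏ j, y (f j)) * T (fun j => EuclideanSpace.single (f j) (1:ℝ)) := by
    intro y
    have hy : y = ∑ i, y i • EuclideanSpace.single i (1:ℝ) := by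
      have := (EuclideanSpace.basisFun (Fin n) ℝ).sum_repr y
      simpa using this.symm
    conv_lhs => rw [hy]
    rw [T.map_sum]
    refine Finset.sum_congr rfl fun f _ => ?_
    rw [T.map_smul_univ]; rfl
  have hprod : ∀ (f : Fin k → Fin n) (y : Rn n), ∏ j, y (f j) =
      ∏ i, y i ^ (Finset.univ.filter (fun j => f j = i)).card := by
    intro f y
    rw [← Finset.prod_fiberwise Finset.univ f]
    refine Finset.prod_congr rfl fun i _ => ?_
    rw [Finset.prod_congr rfl (g := fun _ => y i), Finset.prod_const]
    intro j hj
    rw [(Finset.mem_filter.1 hj).2]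
  simp_rw [hT, Finset.sum_mul]
  rw [integral_finsetSum]
  · refine Finset.sum_eq_zero fun f _ => ?_
    have := hmom (fun i => (Finset.univ.filter (fun j => f j = i)).card) (by
      rw [← Finset.card_eq_sum_card_fiberwise (f := f) (by simp)]; simpa using hk)
    have h2 : ∀ y : Rn n, (∏ j, y (f j)) * T (fun j => EuclideanSpace.single (f j) (1:ℝ)) * a y =
      T (fun j => EuclideanSpace.single (f j) (1:ℝ)) * (a y * ∏ i, y i ^ (Finset.univ.filter (fun j => f j = i)).card) := by
      intro y; rw [hprod]; ring
    simp_rw [h2]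
    rw [integral_const_mul, this, mul_zero]
  · intro f _
    refine ra_int_mul a ha M haM ρ hρ (fun y => (∏ j, y (f j)) * T (fun j => EuclideanSpace.single (f j) (1:ℝ))) ?_
    fun_prop

lemma ra_taylor {n : ℕ} (d : ℕ) (a : Rn n → ℝ) (ha : Measurable a) (M : ℝ) (haM : ∀ x, |a x| ≤ M)
    (ρ : ℝ) (hρ : ∀ x, ρ < ‖x‖ → a x = 0)
    (hmom : ∀ γ : Fin n → ℕ, (∑ i, γ i) ≤ d → ∫ x, a x * ∏ i, x i ^ γ i = 0)
    (ψ : Rn n → ℝ) (hψ : ContDiff ℝ ∞ ψ) (hc : HasCompactSupport ψ) :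
    ∃ C : ℝ, 0 ≤ C ∧ ∀ (u : Rn n) (ε : ℝ), |∫ y, ψ (u + ε • y) * a y| ≤ C * |ε| ^ (d+1) := by
  have hψ' : ContDiff ℝ (d+1 : ℕ) ψ := hψ.of_le (by exact_mod_cast le_top)
  obtain ⟨B, hB⟩ := (hc.iteratedFDeriv (𝕜 := ℝ) (d+1)).exists_bound_of_continuous
    (hψ'.continuous_iteratedFDeriv le_rfl)
  have hB0 : 0 ≤ B := (norm_nonneg _).trans (hB 0)
  have hM : 0 ≤ M := (abs_nonneg _).trans (haM 0)
  let R : ℝ := max ρ 0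
  have hR0 : 0 ≤ R := le_max_right _ _
  let K : ℝ := B * R ^ (d+1) * M
  have hK : 0 ≤ K := by positivity
  refine ⟨K * volume.real (Metric.closedBall (0 : Rn n) ρ), by positivity, fun u ε => ?_⟩
  let P : Rn n → ℝ := fun y => ∑ k ∈ Finset.range (d + 1), (k.factorial : ℝ)⁻¹ • (iteratedFDeriv ℝ k ψ u (fun _ ↦ ε • y))
  have hPc : ∀ k : ℕ, Continuous fun y : Rn n => iteratedFDeriv ℝ k ψ u (fun _ ↦ ε • y) := fun k =>
    (iteratedFDeriv ℝ k ψ u).cont.comp (by fun_prop)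
  have hP : ∫ y, P y * a y = 0 := by
    simp only [P, Finset.sum_mul]
    rw [integral_finsetSum]
    · refine Finset.sum_eq_zero fun k hk => ?_
      have h2 : ∀ y : Rn n, (k.factorial : ℝ)⁻¹ • (iteratedFDeriv ℝ k ψ u (fun _ ↦ ε • y)) * a y
          = ((k.factorial : ℝ)⁻¹ * ε ^ k) * ((iteratedFDeriv ℝ k ψ u (fun _ ↦ y)) * a y) := by
        intro y
        have := (iteratedFDeriv ℝ k ψ u).map_smul_univ (fun _ => ε) (fun _ => y)
        rw [this]
        simp [smul_eq_mul]; ring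
      simp_rw [h2]
      rw [integral_const_mul, ra_poly d a ha M haM ρ hρ hmom k (by simpa [Nat.lt_succ_iff] using hk), mul_zero]
    · intro k _
      exact ra_int_mul a ha M haM ρ hρ _ (by have := hPc k; fun_prop)
  have hPcont : Continuous P := continuous_finsetSum _ fun k _ => by have := hPc k; fun_prop
  have i1 := ra_int_mul a ha M haM ρ hρ (fun y => ψ (u + ε • y)) (by have := hψ.continuous; fun_prop)
  have i2 := ra_int_mul a ha M haM ρ hρ P hPcont
  have h3 : ∫ y, ψ (u + ε • y) * a y = ∫ y, (ψ (u + ε • y) - P y) * a y := by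
    simp_rw [sub_mul]
    rw [integral_sub i1 i2, hP, sub_zero]
  have hrem : ∀ y, |ψ (u + ε • y) - P y| ≤ B * (|ε| * ‖y‖) ^ (d+1) := by
    intro y
    have ht := map_add_eq_sum_add_integral_iteratedFDeriv (n := d) (f := ψ) (x := u) (y := ε • y)
      (fun t _ => hψ'.contDiffAt)
    have ht' : ψ (u + ε • y) - P y = (d.factorial : ℝ)⁻¹ • ∫ t in (0:ℝ)..1, (1 - t)^d • iteratedFDeriv ℝ (d + 1) ψ (u + t • (ε • y)) (fun _ ↦ ε • y) := by
      rw [ht]; simp only [P]; ring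
    rw [ht', ← Real.norm_eq_abs, norm_smul]
    have h5 : ‖∫ t in (0:ℝ)..1, (1 - t)^d • iteratedFDeriv ℝ (d + 1) ψ (u + t • (ε • y)) (fun _ ↦ ε • y)‖ ≤ (B * (|ε| * ‖y‖) ^ (d+1)) * |(1:ℝ) - 0| := by
      refine intervalIntegral.norm_integral_le_of_norm_le_const fun t ht => ?_
      rw [Set.uIoc_of_le zero_le_one] at ht
      rw [norm_smul]
      have h6 : ‖(1 - t)^d‖ ≤ 1 := by
        rw [norm_pow]
        refine pow_le_one₀ (norm_nonneg _) ?_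
        rw [Real.norm_eq_abs, abs_le]; constructor <;> linarith [ht.1, ht.2]
      have h7 : ‖iteratedFDeriv ℝ (d + 1) ψ (u + t • (ε • y)) (fun _ ↦ ε • y)‖ ≤ B * (|ε| * ‖y‖) ^ (d+1) := by
        refine (ContinuousMultilinearMap.le_opNorm _ _).trans ?_
        simp only [norm_smul, Finset.prod_const, Finset.card_univ, Fintype.card_fin, Real.norm_eq_abs]
        gcongr
        exact hB _
      calc _ ≤ 1 * (B * (|ε| * ‖y‖) ^ (d+1)) := by gcongr
        _ = _ := one_mul _
    have h8 : ‖(d.factorial : ℝ)⁻¹‖ ≤ 1 := by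
      rw [norm_inv, Real.norm_natCast]
      exact inv_le_one_of_one_le₀ (by exact_mod_cast Nat.factorial_pos d)
    calc _ ≤ 1 * ((B * (|ε| * ‖y‖) ^ (d+1)) * |(1:ℝ) - 0|) := by gcongr
      _ = _ := by simp
  rw [h3]
  have h9 : ∫ y, (ψ (u + ε • y) - P y) * a y = ∫ y in Metric.closedBall (0 : Rn n) ρ, (ψ (u + ε • y) - P y) * a y := by
    rw [setIntegral_eq_integral_of_forall_compl_eq_zero]
    intro y hy
    rw [hρ y (by simpa using hy), mul_zero]
  rw [h9, ← Real.norm_eq_abs]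
  refine (norm_setIntegral_le_of_norm_le_const (C := K * |ε| ^ (d+1)) (isCompact_closedBall _ _).measure_lt_top ?_).trans (le_of_eq (by ring))
  intro y hy
  rw [norm_mul]
  have hy' : ‖y‖ ≤ R := (by simpa using hy : ‖y‖ ≤ ρ).trans (le_max_left _ _)
  calc _ ≤ (B * (|ε| * R) ^ (d+1)) * M := by
        refine mul_le_mul ((hrem y).trans ?_) (haM y) (norm_nonneg _) (by positivity)
        gcongr
    _ = _ := by simp only [K, mul_pow]; ring

lemma ra_annulus {n : ℕ} (p : ℝ) : ∃ ψ : Rn n → ℝ, ContDiff ℝ ∞ ψ ∧ HasCompactSupport ψ ∧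
    ∀ v, 1/2 ≤ ‖v‖ → ‖v‖ ≤ 3/2 → ψ v = ‖v‖ ^ p := by
  let χ : ContDiffBump (5/4 : ℝ) := ⟨1, 9/8, by norm_num, by norm_num⟩
  refine ⟨fun v => χ (‖v‖ ^ 2) * ‖v‖ ^ p, ?_, ?_, ?_⟩
  · rw [contDiff_iff_contDiffAt]
    intro v
    by_cases hv : v = 0
    · subst hv
      have : (fun v : Rn n => χ (‖v‖ ^ 2) * ‖v‖ ^ p) =ᶠ[nhds 0] fun _ => 0 := by
        have hb : Metric.ball (0 : Rn n) (1/4) ∈ nhds 0 := Metric.ball_mem_nhds _ (by norm_num)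
        filter_upwards [hb] with v hv
        have hv : ‖v‖ < 1/4 := by simpa using hv
        rw [χ.zero_of_le_dist, zero_mul]
        change (9/8 : ℝ) ≤ _
        rw [Real.dist_eq, abs_sub_comm]
        refine le_trans ?_ (le_abs_self _)
        nlinarith [norm_nonneg v]
      exact contDiffAt_const.congr_of_eventuallyEq this
    · have h1 : ContDiffAt ℝ ∞ (fun v : Rn n => ‖v‖) v := contDiffAt_norm ℝ hv
      exact (χ.contDiff.contDiffAt.comp v (h1.pow 2)).mul
        (h1.rpow_const_of_ne (norm_ne_zero_iff.2 hv))
  · refine HasCompactSupport.intro (isCompact_closedBall (0 : Rn n) 2) fun v hv => ?_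
    have hv : 2 < ‖v‖ := by simpa using hv
    rw [χ.zero_of_le_dist, zero_mul]
    change (9/8 : ℝ) ≤ _
    rw [Real.dist_eq]
    refine le_trans ?_ (le_abs_self _)
    nlinarith [norm_nonneg v]
  · intro v h1 h2
    change χ (‖v‖ ^ 2) * ‖v‖ ^ p = _
    rw [χ.one_of_mem_closedBall, one_mul]
    change dist _ _ ≤ (1 : ℝ)
    rw [Real.dist_eq, abs_le]
    constructor <;> nlinarith

lemma ra_decay {n : ℕ} (α : ℝ) (d : ℕ) (a : Rn n → ℝ) (ha : Measurable a) (M : ℝ)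
    (haM : ∀ x, |a x| ≤ M)
    (ρ : ℝ) (hρ1 : 1 ≤ ρ) (hρ : ∀ x, ρ < ‖x‖ → a x = 0)
    (hmom : ∀ γ : Fin n → ℕ, (∑ i, γ i) ≤ d → ∫ x, a x * ∏ i, x i ^ γ i = 0) :
    ∃ C : ℝ, 0 ≤ C ∧ ∀ x : Rn n, 2 * ρ ≤ ‖x‖ →
      |riesz α a x| ≤ C * (‖x‖ ^ (α - (n:ℝ)) * (‖x‖⁻¹) ^ (d + 1)) := by
  obtain ⟨ψ, h1, h2, h3⟩ := ra_annulus (n := n) (α - (n:ℝ))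
  obtain ⟨C, hC0, hC⟩ := ra_taylor d a ha M haM ρ hρ hmom ψ h1 h2
  refine ⟨C, hC0, fun x hx => ?_⟩
  have hx0 : 0 < ‖x‖ := by linarith
  have : riesz α a x = ‖x‖ ^ (α - (n:ℝ)) * ∫ y, ψ (‖x‖⁻¹ • x + (-‖x‖⁻¹) • y) * a y := by
    unfold riesz
    rw [← integral_const_mul]
    congr 1
    ext y
    by_cases hy : ρ < ‖y‖
    · simp [hρ y hy]
    · push Not at hy
      have e : ‖x‖⁻¹ • x + (-‖x‖⁻¹) • y = ‖x‖⁻¹ • (x - y) := by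
        rw [smul_sub, neg_smul, sub_eq_add_neg]
      have e2 : ‖‖x‖⁻¹ • (x - y)‖ = ‖x - y‖ / ‖x‖ := by
        rw [norm_smul, norm_inv, norm_norm]; field_simp
      have l1 : ‖x‖ - ‖y‖ ≤ ‖x - y‖ := norm_sub_norm_le x y
      have l2 : ‖x - y‖ ≤ ‖x‖ + ‖y‖ := norm_sub_le x y
      rw [e, h3, e2, Real.div_rpow (norm_nonneg _) (norm_nonneg _)]
      · have : ‖x‖ ^ (α - (n:ℝ)) ≠ 0 := (Real.rpow_pos_of_pos hx0 _).ne'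
        field_simp
      · rw [e2, le_div_iff₀ hx0]; linarith
      · rw [e2, div_le_iff₀ hx0]; linarith
  rw [this, abs_mul, abs_of_nonneg (Real.rpow_nonneg (norm_nonneg _) _)]
  have := hC (‖x‖⁻¹ • x) (-‖x‖⁻¹)
  rw [abs_neg, abs_of_nonneg (inv_nonneg.2 (norm_nonneg x))] at this
  calc _ ≤ ‖x‖ ^ (α - (n:ℝ)) * (C * (‖x‖⁻¹) ^ (d + 1)) := by gcongr
    _ = _ := by ring

lemma ra_locint {n : ℕ} (hn : 0 < n) (α : ℝ) (hα0 : 0 < α) :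
    LocallyIntegrable (fun w : Rn n => ‖w‖ ^ (α - (n:ℝ))) := by
  refine locallyIntegrable_of_norm_le_rpow (C := 1) (α := n - α) (by simpa using Nat.succ_le_of_lt hn) (by simpa using hα0)
    (Filter.Eventually.of_forall fun w => ?_) ?_
  · rw [Real.norm_of_nonneg (Real.rpow_nonneg (norm_nonneg _) _), one_mul, neg_sub]
  · exact Measurable.aestronglyMeasurable (by fun_prop)

lemma ra_kball {n : ℕ} (hn : 0 < n) (α : ℝ) (hα0 : 0 < α) (hαn : α < n) :
    ∃ C : ℝ, 0 ≤ C ∧ ∀ T : ℝ, 1 ≤ T →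
      ∫ w in Metric.closedBall (0 : Rn n) T, ‖w‖ ^ (α - (n:ℝ)) ≤ C * T ^ n := by
  have hL := ra_locint hn α hα0
  set A := ∫ w in Metric.closedBall (0 : Rn n) 1, ‖w‖ ^ (α - (n:ℝ)) with hA
  have hA0 : 0 ≤ A := integral_nonneg fun w => Real.rpow_nonneg (norm_nonneg _) _
  refine ⟨A + volume.real (Metric.closedBall (0 : Rn n) 1), by positivity, fun T hT => ?_⟩
  have hi : ∀ t, IntegrableOn (fun w : Rn n => ‖w‖ ^ (α - (n:ℝ))) (Metric.closedBall 0 t) := fun t =>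
    hL.integrableOn_isCompact (isCompact_closedBall _ _)
  have hsub : Metric.closedBall (0 : Rn n) 1 ⊆ Metric.closedBall 0 T := Metric.closedBall_subset_closedBall hT
  have h1 : ∫ w in Metric.closedBall (0 : Rn n) T \ Metric.closedBall 0 1, ‖w‖ ^ (α - (n:ℝ))
      ≤ volume.real (Metric.closedBall (0 : Rn n) T) := by
    have hm : MeasurableSet (Metric.closedBall (0 : Rn n) T \ Metric.closedBall 0 1) :=
      Metric.isClosed_closedBall.measurableSet.diff Metric.isClosed_closedBall.measurableSet
    have hf : volume (Metric.closedBall (0 : Rn n) T \ Metric.closedBall 0 1) < ⊤ :=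
      (measure_mono Set.sdiff_subset).trans_lt (isCompact_closedBall _ _).measure_lt_top
    have := norm_setIntegral_le_of_norm_le_const (C := 1) (f := fun w : Rn n => ‖w‖ ^ (α - (n:ℝ))) hf (fun w hw => by
      rw [Real.norm_of_nonneg (Real.rpow_nonneg (norm_nonneg _) _)]
      have : 1 < ‖w‖ := by simpa using hw.2
      exact Real.rpow_le_one_of_one_le_of_nonpos this.le (by linarith))
    refine (le_abs_self _).trans (this.trans ?_)
    rw [one_mul]
    exact measureReal_mono Set.sdiff_subset (isCompact_closedBall _ _).measure_lt_top.ne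
  have h2 := setIntegral_sdiff (μ := volume) (Metric.isClosed_closedBall (x := (0 : Rn n)) (ε := 1)).measurableSet (hi T) hsub
  have h3 : volume.real (Metric.closedBall (0 : Rn n) T) = T ^ n * volume.real (Metric.closedBall (0 : Rn n) 1) := by
    have := Measure.addHaar_real_closedBall' (volume : Measure (Rn n)) 0 (r := T) (by linarith)
    simpa using this
  have h4 : 1 ≤ T ^ n := one_le_pow₀ hT
  rw [h2, h3] at h1
  nlinarith

lemma ra_riesz_eq {n : ℕ} (α : ℝ) (a : Rn n → ℝ) (x : Rn n) :
    riesz α a x = ∫ w, ‖w‖ ^ (α - (n:ℝ)) * a (x - w) := by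
  unfold riesz
  rw [← integral_sub_left_eq_self (fun w => ‖w‖ ^ (α - (n:ℝ)) * a (x - w)) volume x]
  simp

lemma ra_riesz_meas {n : ℕ} (α : ℝ) (a : Rn n → ℝ) (ha : Measurable a) :
    StronglyMeasurable (riesz α a) := by
  have : StronglyMeasurable (Function.uncurry fun (x y : Rn n) => ‖x - y‖ ^ (α - (n:ℝ)) * a y) := by
    apply Measurable.stronglyMeasurable
    unfold Function.uncurry
    fun_prop
  exact this.integral_prod_right

lemma ra_bdd {n : ℕ} (hn : 0 < n) (α : ℝ) (hα0 : 0 < α) (a : Rn n → ℝ) (M : ℝ)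
    (haM : ∀ x, |a x| ≤ M) (ρ : ℝ) (hρ : ∀ x, ρ < ‖x‖ → a x = 0) (T : ℝ) :
    ∃ B : ℝ, 0 ≤ B ∧ ∀ x : Rn n, ‖x‖ ≤ T → |riesz α a x| ≤ B := by
  have hL := ra_locint hn α hα0
  have hM : 0 ≤ M := (abs_nonneg _).trans (haM 0)
  refine ⟨∫ w in Metric.closedBall (0 : Rn n) (T + ρ), ‖w‖ ^ (α - (n:ℝ)) * M, ?_, fun x hx => ?_⟩
  · exact integral_nonneg fun w => mul_nonneg (Real.rpow_nonneg (norm_nonneg _) _) hM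
  · rw [ra_riesz_eq, ← setIntegral_eq_integral_of_forall_compl_eq_zero (s := Metric.closedBall (0 : Rn n) (T + ρ))]
    · refine norm_integral_le_of_norm_le (f := fun w => ‖w‖ ^ (α - (n:ℝ)) * a (x - w))
        ((hL.integrableOn_isCompact (isCompact_closedBall _ _)).mul_const M)
        (Filter.Eventually.of_forall fun w => ?_)
      rw [norm_mul, Real.norm_of_nonneg (Real.rpow_nonneg (norm_nonneg _) _)]
      exact mul_le_mul_of_nonneg_left (haM _) (Real.rpow_nonneg (norm_nonneg _) _)
    · intro w hw
      have hw : T + ρ < ‖w‖ := by simpa using hw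
      have : ‖w‖ - ‖x‖ ≤ ‖x - w‖ := by rw [norm_sub_rev]; exact norm_sub_norm_le w x
      rw [hρ _ (by linarith), mul_zero]

lemma ra_fubini {n : ℕ} (hn : 0 < n) (α : ℝ) (hα0 : 0 < α) (a : Rn n → ℝ) (ha : Measurable a) (M : ℝ)
    (haM : ∀ x, |a x| ≤ M) (ρ : ℝ) (hρ : ∀ x, ρ < ‖x‖ → a x = 0) (T : ℝ)
    (φ : Rn n → ℝ) (hφ : Continuous φ) (hφT : ∀ x, T < ‖x‖ → φ x = 0) :
    ∫ x, φ x * riesz α a x = ∫ w, ‖w‖ ^ (α - (n:ℝ)) * ∫ y, φ (w + y) * a y := by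
  have hL := ra_locint hn α hα0
  have hM : 0 ≤ M := (abs_nonneg _).trans (haM 0)
  obtain ⟨K, hK⟩ := (isCompact_closedBall (0 : Rn n) T).exists_bound_of_continuousOn hφ.continuousOn
  have hB := fun t : ℝ => (Metric.isClosed_closedBall (x := (0 : Rn n)) (ε := t)).measurableSet
  have hint : Integrable (Function.uncurry fun (x w : Rn n) => φ x * (‖w‖ ^ (α - (n:ℝ)) * a (x - w)))
      (volume.prod volume) := by
    have g1 : Integrable ((Metric.closedBall (0 : Rn n) T).indicator (fun _ => K)) :=
      (integrable_indicator_iff (hB _)).2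
        (integrableOn_const (isCompact_closedBall _ _).measure_lt_top.ne)
    have g2 : Integrable ((Metric.closedBall (0 : Rn n) (T + ρ)).indicator (fun w => ‖w‖ ^ (α - (n:ℝ)) * M)) :=
      (integrable_indicator_iff (hB _)).2
        ((hL.integrableOn_isCompact (isCompact_closedBall _ _)).mul_const M)
    refine (g1.mul_prod g2).mono' ?_ (Filter.Eventually.of_forall ?_)
    · apply Measurable.aestronglyMeasurable
      unfold Function.uncurry
      have := hφ.measurable
      fun_prop
    · rintro ⟨x, w⟩
      simp only [Function.uncurry]
      have hr : 0 ≤ ‖w‖ ^ (α - (n:ℝ)) := Real.rpow_nonneg (norm_nonneg _) _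
      by_cases hx : x ∈ Metric.closedBall (0 : Rn n) T
      · have hKx := hK x hx
        have hK0 : 0 ≤ K := (norm_nonneg _).trans hKx
        rw [Set.indicator_of_mem hx]
        by_cases hw : w ∈ Metric.closedBall (0 : Rn n) (T + ρ)
        · rw [Set.indicator_of_mem hw, norm_mul, norm_mul, Real.norm_of_nonneg hr]
          have := haM (x - w)
          rw [← Real.norm_eq_abs] at this
          gcongr
        · rw [Set.indicator_of_notMem hw]
          have hw : T + ρ < ‖w‖ := by simpa using hw
          have hx : ‖x‖ ≤ T := by simpa using hx
          have : ‖w‖ - ‖x‖ ≤ ‖x - w‖ := by rw [norm_sub_rev]; exact norm_sub_norm_le w x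
          rw [hρ _ (by linarith)]
          simp
      · rw [Set.indicator_of_notMem hx, hφT x (by simpa using hx)]
        simp
  calc ∫ x, φ x * riesz α a x = ∫ x, ∫ w, φ x * (‖w‖ ^ (α - (n:ℝ)) * a (x - w)) := by
        congr 1; ext x; rw [ra_riesz_eq, integral_const_mul]
    _ = ∫ w, ∫ x, φ x * (‖w‖ ^ (α - (n:ℝ)) * a (x - w)) := integral_integral_swap hint
    _ = _ := by
        congr 1; ext w
        rw [← integral_const_mul, ← integral_add_left_eq_self _ w]
        congr 1; ext y
        rw [add_sub_cancel_left]; ring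

lemma ra_mono {n : ℕ} (β : Fin n → ℕ) (x : Rn n) : |∏ i, x i ^ β i| ≤ ‖x‖ ^ (∑ i, β i) := by
  rw [Finset.abs_prod, ← Finset.prod_pow_eq_pow_sum]
  refine Finset.prod_le_prod (fun _ _ => abs_nonneg _) fun i _ => ?_
  rw [abs_pow]
  gcongr
  exact PiLp.norm_apply_le x i

lemma ra_cube {n : ℕ} (z : Rn n) (r : ℝ) : ∃ ρ : ℝ, 1 ≤ ρ ∧ ∀ x ∈ cube z r, ‖x‖ ≤ ρ := by
  refine ⟨max 1 (∑ i, (|z i| + r / 2)), le_max_left _ _, fun x hx => le_max_of_le_right ?_⟩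
  have hy : x = ∑ i, x i • EuclideanSpace.single i (1:ℝ) := by
    have := (EuclideanSpace.basisFun (Fin n) ℝ).sum_repr x
    simpa using this.symm
  rw [hy]
  refine (norm_sum_le _ _).trans (Finset.sum_le_sum fun i _ => ?_)
  rw [norm_smul, EuclideanSpace.norm_single, norm_one, mul_one, Real.norm_eq_abs]
  have := hx i
  have h2 : |x i| ≤ |x i - z i| + |z i| := by
    simpa using abs_add_le (x i - z i) (z i)
  linarith

lemma ra_integrable {n : ℕ} (hn : 0 < n)
    (α : ℝ) (hα0 : 0 < α)
    (s : ℕ) (d : ℕ) (hd : 2 * (s : ℝ) + 2 + α + n ≤ (d : ℝ))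
    (a : Rn n → ℝ) (ha : Measurable a) (M : ℝ) (haM : ∀ x, |a x| ≤ M)
    (ρ : ℝ) (hρ1 : 1 ≤ ρ) (hρ : ∀ x, ρ < ‖x‖ → a x = 0)
    (hmom : ∀ γ : Fin n → ℕ, (∑ i, γ i) ≤ d → ∫ x, a x * ∏ i, x i ^ γ i = 0)
    (β : Fin n → ℕ) (hβ : (∑ i, β i) ≤ s) :
    Integrable (fun x : Rn n => (∏ i, x i ^ β i) * riesz α a x) := by
  obtain ⟨C, hC0, hC⟩ := ra_decay α d a ha M haM ρ hρ1 hρ hmom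
  obtain ⟨B, hB0, hB⟩ := ra_bdd hn α hα0 a M haM ρ hρ (2 * ρ)
  have key : ∀ x : Rn n, (1 + ‖x‖) ^ (n + 1) * |(∏ i, x i ^ β i) * riesz α a x| ≤
      (1 + 2 * ρ) ^ (n + 1 + s) * B + 2 ^ (n + 1 + s) * C := by
    intro x
    have hx0 := norm_nonneg x
    have hm : |∏ i, x i ^ β i| ≤ (1 + ‖x‖) ^ s :=
      (ra_mono β x).trans ((pow_le_pow_left₀ hx0 (by linarith) _).trans
        (pow_le_pow_right₀ (by linarith) hβ))
    have h1 : (1 + ‖x‖) ^ (n + 1) * |(∏ i, x i ^ β i) * riesz α a x| ≤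
        (1 + ‖x‖) ^ (n + 1 + s) * |riesz α a x| := by
      rw [abs_mul, pow_add _ (n+1) s, mul_assoc]
      gcongr
    rcases le_total ‖x‖ (2 * ρ) with h | h
    · calc _ ≤ _ := h1
        _ ≤ (1 + 2 * ρ) ^ (n + 1 + s) * B := by
          gcongr
          exact hB x h
        _ ≤ _ := le_add_of_nonneg_right (by positivity)
    · have hx1 : 1 ≤ ‖x‖ := by linarith
      have hxp : 0 < ‖x‖ := by linarith
      have e : ‖x‖ ^ (n + 1 + s) * (‖x‖ ^ (α - (n:ℝ)) * (‖x‖⁻¹) ^ (d + 1)) ≤ 1 := by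
        rw [inv_pow, ← Real.rpow_natCast, ← Real.rpow_natCast, ← Real.rpow_neg hx0, ← Real.rpow_add hxp,
          ← Real.rpow_add hxp]
        apply Real.rpow_le_one_of_one_le_of_nonpos hx1
        push_cast
        have : (0:ℝ) ≤ s := Nat.cast_nonneg s
        have : (0:ℝ) ≤ n := Nat.cast_nonneg n
        linarith
      calc _ ≤ _ := h1
        _ ≤ (2 * ‖x‖) ^ (n + 1 + s) * (C * (‖x‖ ^ (α - (n:ℝ)) * (‖x‖⁻¹) ^ (d + 1))) := by
          gcongr
          · linarith
          · exact hC x h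
        _ = 2 ^ (n + 1 + s) * C * (‖x‖ ^ (n + 1 + s) * (‖x‖ ^ (α - (n:ℝ)) * (‖x‖⁻¹) ^ (d + 1))) := by
          rw [mul_pow]; ring
        _ ≤ 2 ^ (n + 1 + s) * C * 1 := by gcongr
        _ ≤ _ := by
          rw [mul_one]
          exact le_add_of_nonneg_left (by positivity)
  have hJ : Integrable (fun x : Rn n => (1 + ‖x‖) ^ (-((n:ℝ) + 1))) :=
    integrable_one_add_norm (by simp)
  refine (hJ.const_mul ((1 + 2 * ρ) ^ (n + 1 + s) * B + 2 ^ (n + 1 + s) * C)).mono' ?_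
    (Filter.Eventually.of_forall fun x => ?_)
  · refine AEStronglyMeasurable.mul ?_ (ra_riesz_meas α a ha).aestronglyMeasurable
    have : Continuous fun x : Rn n => ∏ i, x i ^ β i := by fun_prop
    exact this.aestronglyMeasurable
  · have hp : 0 < 1 + ‖x‖ := by positivity
    have e : (1 + ‖x‖) ^ (-((n:ℝ) + 1)) = ((1 + ‖x‖) ^ (n + 1))⁻¹ := by
      rw [Real.rpow_neg hp.le]; norm_cast
    rw [e, ← div_eq_mul_inv, le_div_iff₀ (by positivity), mul_comm]
    exact key x

lemma ra_zero {n : ℕ} (hn : 0 < n)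
    (α : ℝ) (hα0 : 0 < α) (hαn : α < n)
    (s : ℕ) (d : ℕ) (hd : 2 * (s : ℝ) + 2 + α + n ≤ (d : ℝ))
    (a : Rn n → ℝ) (ha : Measurable a) (M : ℝ) (haM : ∀ x, |a x| ≤ M)
    (ρ : ℝ) (hρ1 : 1 ≤ ρ) (hρ : ∀ x, ρ < ‖x‖ → a x = 0)
    (hmom : ∀ γ : Fin n → ℕ, (∑ i, γ i) ≤ d → ∫ x, a x * ∏ i, x i ^ γ i = 0)
    (β : Fin n → ℕ) (hβ : (∑ i, β i) ≤ s) :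
    ∫ x : Rn n, (∏ i, x i ^ β i) * riesz α a x = 0 := by
  have hI := ra_integrable hn α hα0 s d hd a ha M haM ρ hρ1 hρ hmom β hβ
  have hL := ra_locint hn α hα0
  let η : ContDiffBump (0 : Rn n) := ⟨1, 2, by norm_num, by norm_num⟩
  let φ : Rn n → ℝ := fun x => (∏ i, x i ^ β i) * η x
  have hφ : ContDiff ℝ ∞ φ := by
    refine ContDiff.mul ?_ η.contDiff
    refine contDiff_prod fun i _ => ContDiff.pow ?_ _
    exact (EuclideanSpace.proj (𝕜 := ℝ) i).contDiff
  have hη0 : ∀ x : Rn n, 2 < ‖x‖ → η x = 0 := fun x hx =>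
    η.zero_of_le_dist (by simpa using hx.le)
  have hφc : HasCompactSupport φ :=
    HasCompactSupport.intro (isCompact_closedBall (0 : Rn n) 2) fun v hv => by
      simp only [φ]
      rw [hη0 v (by simpa using hv), mul_zero]
  obtain ⟨C, hC0, hC⟩ := ra_taylor d a ha M haM ρ hρ hmom φ hφ hφc
  obtain ⟨D, hD0, hD⟩ := ra_kball hn α hα0 hαn
  have hnd : s + n + 1 ≤ d + 1 := by
    have : (s:ℝ) + n + 1 ≤ d + 1 := by
      have : (0:ℝ) ≤ s := Nat.cast_nonneg s
      linarith
    exact_mod_cast this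
  let F : ℕ → ℝ := fun k => ∫ x : Rn n, ((∏ i, x i ^ β i) * η (((k:ℝ)+1)⁻¹ • x)) * riesz α a x
  have hF1 : Filter.Tendsto F Filter.atTop (nhds (∫ x : Rn n, (∏ i, x i ^ β i) * riesz α a x)) := by
    refine tendsto_integral_of_dominated_convergence (fun x => ‖(∏ i, x i ^ β i) * riesz α a x‖) ?_ hI.norm ?_ ?_
    · intro k
      refine AEStronglyMeasurable.mul ?_ (ra_riesz_meas α a ha).aestronglyMeasurable
      have := η.continuous
      have : Continuous fun x : Rn n => (∏ i, x i ^ β i) * η (((k:ℝ)+1)⁻¹ • x) := by fun_prop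
      exact this.aestronglyMeasurable
    · intro k
      refine Filter.Eventually.of_forall fun x => ?_
      rw [mul_right_comm, norm_mul]
      refine mul_le_of_le_one_right (norm_nonneg _) ?_
      rw [Real.norm_of_nonneg η.nonneg]
      exact η.le_one
    · refine Filter.Eventually.of_forall fun x => ?_
      refine tendsto_const_nhds.congr' ?_
      filter_upwards [Filter.eventually_ge_atTop ⌈‖x‖⌉₊] with k hk
      have hk' : ‖x‖ ≤ k := (Nat.le_ceil _).trans (by exact_mod_cast hk)
      rw [η.one_of_mem_closedBall, mul_one]
      have hk1 : (0:ℝ) < (k:ℝ) + 1 := by positivity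
      change _ ∈ Metric.closedBall (0 : Rn n) 1
      rw [mem_closedBall_zero_iff, norm_smul, norm_inv, Real.norm_of_nonneg hk1.le, inv_mul_le_iff₀ hk1]
      linarith
  have hF2 : ∀ k, |F k| ≤ (C * (D * (2 + ρ) ^ n)) * (1 / ((k:ℝ) + 1)) := by
    intro k
    set R : ℝ := (k:ℝ) + 1 with hR
    have hk0 : (0:ℝ) ≤ k := Nat.cast_nonneg k
    have hR1 : 1 ≤ R := by linarith
    have hR0 : 0 < R := by linarith
    have hscale : ∀ x : Rn n, (∏ i, x i ^ β i) * η (R⁻¹ • x) = R ^ (∑ i, β i) * φ (R⁻¹ • x) := by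
      intro x
      simp only [φ]
      rw [← mul_assoc, ← Finset.prod_pow_eq_pow_sum, ← Finset.prod_mul_distrib]
      congr 2
      ext i
      rw [← mul_pow]
      congr 1
      simp only [PiLp.smul_apply, smul_eq_mul]
      field_simp
    have hz : ∀ x : Rn n, 2 * R < ‖x‖ → (∏ i, x i ^ β i) * η (R⁻¹ • x) = 0 := by
      intro x hx
      rw [hη0, mul_zero]
      rw [norm_smul, norm_inv, Real.norm_of_nonneg hR0.le, lt_inv_mul_iff₀ hR0]
      linarith
    have hcont : Continuous fun x : Rn n => (∏ i, x i ^ β i) * η (R⁻¹ • x) := by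
      have := η.continuous
      fun_prop
    have hfub := ra_fubini hn α hα0 a ha M haM ρ hρ (2 * R) (fun x : Rn n => (∏ i, x i ^ β i) * η (R⁻¹ • x)) hcont hz
    set G : Rn n → ℝ := fun w => ∫ y, (∏ i, (w + y) i ^ β i) * η (R⁻¹ • (w + y)) * a y with hG
    have hGb : ∀ w, |G w| ≤ R ^ (∑ i, β i) * (C * (R⁻¹) ^ (d + 1)) := by
      intro w
      have : G w = R ^ (∑ i, β i) * ∫ y, φ (R⁻¹ • w + R⁻¹ • y) * a y := by
        rw [← integral_const_mul]
        simp only [hG]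
        congr 1; ext y
        rw [hscale, smul_add, mul_assoc]
      rw [this, abs_mul, abs_of_nonneg (by positivity)]
      have h5 := hC (R⁻¹ • w) R⁻¹
      rw [abs_of_nonneg (inv_nonneg.2 hR0.le)] at h5
      gcongr
    have hGz : ∀ w, 2 * R + ρ < ‖w‖ → G w = 0 := by
      intro w hw
      simp only [hG]
      rw [← integral_zero (Rn n) ℝ]
      congr 1; ext y
      by_cases hy : ρ < ‖y‖
      · rw [hρ y hy, mul_zero]
      · push Not at hy
        rw [hz, zero_mul]
        have : ‖w‖ - ‖-y‖ ≤ ‖w - -y‖ := norm_sub_norm_le w (-y)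
        rw [norm_neg, sub_neg_eq_add] at this
        linarith
    have hFk : F k = ∫ w in Metric.closedBall (0 : Rn n) ((2 + ρ) * R), ‖w‖ ^ (α - (n:ℝ)) * G w := by
      change ∫ x : Rn n, ((∏ i, x i ^ β i) * η (R⁻¹ • x)) * riesz α a x = _
      rw [hfub, setIntegral_eq_integral_of_forall_compl_eq_zero]
      intro w hw
      have hw : (2 + ρ) * R < ‖w‖ := by simpa using hw
      rw [hGz w (by nlinarith), mul_zero]
    set E : ℝ := R ^ (∑ i, β i) * (C * (R⁻¹) ^ (d + 1)) with hE
    have hE0 : 0 ≤ E := by positivity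
    have hb : |F k| ≤ ∫ w in Metric.closedBall (0 : Rn n) ((2 + ρ) * R), ‖w‖ ^ (α - (n:ℝ)) * E := by
      rw [hFk]
      refine norm_integral_le_of_norm_le (f := fun w => ‖w‖ ^ (α - (n:ℝ)) * G w)
        ((hL.integrableOn_isCompact (isCompact_closedBall _ _)).mul_const E)
        (Filter.Eventually.of_forall fun w => ?_)
      rw [norm_mul, Real.norm_of_nonneg (Real.rpow_nonneg (norm_nonneg _) _)]
      exact mul_le_mul_of_nonneg_left (hGb _) (Real.rpow_nonneg (norm_nonneg _) _)
    rw [integral_mul_const] at hb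
    have hT : 1 ≤ (2 + ρ) * R := by nlinarith
    have h7 : R ^ (∑ i, β i) * R ^ n * (R⁻¹) ^ (d + 1) ≤ 1 / R := by
      rw [← pow_add, inv_pow, ← div_eq_mul_inv, div_le_div_iff₀ (by positivity) hR0, one_mul, ← pow_succ]
      exact pow_le_pow_right₀ hR1 (by omega)
    calc |F k| ≤ _ := hb
      _ ≤ (D * ((2 + ρ) * R) ^ n) * E := by gcongr; exact hD _ hT
      _ = (C * (D * (2 + ρ) ^ n)) * (R ^ (∑ i, β i) * R ^ n * (R⁻¹) ^ (d + 1)) := by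
        rw [hE, mul_pow]; ring
      _ ≤ _ := by gcongr
  have hF3 : Filter.Tendsto F Filter.atTop (nhds 0) := by
    refine squeeze_zero_norm hF2 ?_
    simpa using tendsto_one_div_add_atTop_nhds_zero_nat.const_mul (C * (D * (2 + ρ) ^ n))
  exact tendsto_nhds_unique hF1 hF3

end RA

theorem riesz_atom_moment_condition
    {n : ℕ} (hn : 0 < n)
    (α : ℝ) (hα0 : 0 < α) (hαn : α < n)
    (s : ℕ) (d : ℕ) (hd : 2 * (s : ℝ) + 2 + α + n ≤ (d : ℝ))
    (a : Rn n → ℝ) (ha : Measurable a) (M : ℝ) (haM : ∀ x, |a x| ≤ M)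
    (z : Rn n) (r : ℝ) (hr : 0 < r) (hsupp : ∀ x, x ∉ cube z r → a x = 0)
    (hmom : ∀ γ : Fin n → ℕ, (∑ i, γ i) ≤ d → ∫ x, a x * ∏ i, x i ^ γ i = 0) :
    ∀ β : Fin n → ℕ, (∑ i, β i) ≤ s →
      Integrable (fun x => (∏ i, x i ^ β i) * riesz α a x) ∧
      ∫ x, (∏ i, x i ^ β i) * riesz α a x = 0 := by
  obtain ⟨ρ, hρ1, hρc⟩ := ra_cube z r
  have hρ : ∀ x, ρ < ‖x‖ → a x = 0 := fun x hx =>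
    hsupp x fun h => absurd (hρc x h) (not_le.2 hx)
  intro β hβ
  exact ⟨ra_integrable hn α hα0 s d hd a ha M haM ρ hρ1 hρ hmom β hβ,
    ra_zero hn α hα0 hαn s d hd a ha M haM ρ hρ1 hρ hmom β hβ⟩
end
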